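/- arXiv:1805.02542 — 4 statements merged into one kernel-verified Lean document; each statement's English description precedes it below -/
import Mathlib

section
/- Let $P$ be the uniform distribution on $[0,1]$. For any $\gamma\in(0,1]$ there exists a uniformly bounded VC-subgraph class $\tilde{\mathcal{F}}$ of functions on $[0,1]$ and some $f_0\in\tilde{\mathcal{F}}$ such that $\tilde{\mathcal{F}}_0\equiv\tilde{\mathcal{F}}-f_0$ satisfies the envelope growth condition $\|F_0(\delta)\|_{L_2(P)}\le c\,\delta^{\gamma}$ for all $\delta>0$ (for some $c>0$), with the following property: for each $\epsilon\in(0,1/2)$ there exist constants $c_{\epsilon,\gamma}>0$, $\mathfrak{p}>0$ and a law for the i.i.d. mean-zero errors $\xi_i$ with $\|\xi_1\|_{2(1-\epsilon)}<\infty$ such that, for $n$ large enough depending on $\epsilon,\gamma$, in the regression model $Y_i=f_0(X_i)+\xi_i$ with $X_i$ i.i.d. $P$ there exists a least squares estimator $f_n^{\ast}$ over $\tilde{\mathcal{F}}$ whose $L_2$ loss satisfies $\|f_n^{\ast}-f_0\|_{L_2(P)}\ge c_{\epsilon,\gamma}\, n^{-\frac{1}{2(2-\gamma)}-(2/\gamma)\epsilon}$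 with probability at least $\mathfrak{p}$. -/
open MeasureTheory ProbabilityTheory Set
open scoped ENNReal

noncomputable section

/-- `log x` with the convention `log x = log (x ⊔ e)`. -/
def plog (x : ℝ) : ℝ := Real.log (max x (Real.exp 1))

/-- The `L_{p,1}` norm of a random variable:
`‖ξ‖_{p,1} = ∫_0^∞ P(|ξ| > t)^{1/p} dt`. -/
def Lp1 {Ω : Type*} [MeasurableSpace Ω] (μ : Measure Ω) (p : ℝ) (ξ : Ω → ℝ) : ℝ≥0∞ :=
  ∫⁻ t in Set.Ioi (0 : ℝ), μ {ω | t < |ξ ω|} ^ (1 / p)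

/-- A family of sets `C` shatters a finite set `s`. -/
def Shatters {α : Type*} (C : Set (Set α)) (s : Finset α) : Prop :=
  ∀ t : Finset α, t ⊆ s → ∃ c ∈ C, ∀ x ∈ s, x ∈ c ↔ x ∈ t

/-- A family of sets is a VC class if the cardinality of shattered sets is uniformly bounded. -/
def IsVCClass {α : Type*} (C : Set (Set α)) : Prop :=
  ∃ d : ℕ, ∀ s : Finset α, Shatters C s → s.card ≤ d

/-- A class of functions is VC-subgraph if the class of subgraphs is a VC class of sets. -/
def IsVCSubgraph {α : Type*} (F : Set (α → ℝ)) : Prop :=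
  IsVCClass ((fun f => {p : α × ℝ | p.2 < f p.1}) '' F)

/-- A class of functions is VC-major if the class of (super-)level sets is a VC class of sets. -/
def IsVCMajor {α : Type*} (F : Set (α → ℝ)) : Prop :=
  IsVCClass {s : Set α | ∃ f ∈ F, ∃ t : ℝ, s = {x | t ≤ f x}}

/-- The (pointwise smallest) envelope of a class of functions. -/
def envl {α : Type*} (G : Set (α → ℝ)) : α → ℝ := fun x => sSup ((fun f => |f x|) '' G)

/-- The uniform distribution on `[0,1]`. -/
def unif01 : Measure ℝ := volume.restrict (Set.Icc 0 1)

/-- The uniform distribution on `[0,1]²`. -/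
def unif01sq : Measure (ℝ × ℝ) := volume.restrict (Set.Icc 0 1 ×ˢ Set.Icc 0 1)

/-- The (external) covering number of `S` at scale `ε` for the (pseudo-)distance `d`. -/
def covN {α : Type*} (ε : ℝ) (d : α → α → ℝ) (S : Set α) : ℝ≥0∞ :=
  sInf {n : ℝ≥0∞ | ∃ T : Finset α, (T.card : ℝ≥0∞) = n ∧ ∀ f ∈ S, ∃ g ∈ T, d f g ≤ ε}

/-- sup-norm distance over `[0,1]`. -/
def supDist (f g : ℝ → ℝ) : ℝ := sSup ((fun x => |f x - g x|) '' Set.Icc (0 : ℝ) 1)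

/-- `L₂(Q)` distance. -/
def l2Dist {α : Type*} [MeasurableSpace α] (Q : Measure α) (f g : α → ℝ) : ℝ :=
  Real.sqrt (∫ x, (f x - g x) ^ 2 ∂Q)

/-- `L₂(Q)` norm. -/
def l2Norm {α : Type*} [MeasurableSpace α] (Q : Measure α) (f : α → ℝ) : ℝ :=
  Real.sqrt (∫ x, f x ^ 2 ∂Q)

/-- The isotonic model: monotone non-decreasing functions on `[0,1]`. -/
def IsoModel : Set (ℝ → ℝ) := {f | MonotoneOn f (Set.Icc 0 1)}

/-- The convex model: convex functions on `[0,1]`. -/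
def ConvModel : Set (ℝ → ℝ) := {f | ConvexOn ℝ (Set.Icc 0 1) f}

/-- Non-decreasing piecewise constant functions on `[0,1]` with at most `m` pieces. -/
def Mm (m : ℕ) : Set (ℝ → ℝ) :=
  {f | MonotoneOn f (Set.Icc 0 1) ∧ ∃ a : ℕ → ℝ, a 0 = 0 ∧ a m = 1 ∧ Monotone a ∧
        ∃ c : ℕ → ℝ, ∀ j < m, ∀ x ∈ Set.Ioc (a j) (a (j + 1)), f x = c j}

/-- Convex piecewise linear functions on `[0,1]` with at most `m` pieces. -/
def Cm (m : ℕ) : Set (ℝ → ℝ) :=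
  {f | ConvexOn ℝ (Set.Icc 0 1) f ∧ ∃ a : ℕ → ℝ, a 0 = 0 ∧ a m = 1 ∧ Monotone a ∧
        ∃ p q : ℕ → ℝ, ∀ j < m, ∀ x ∈ Set.Ioc (a j) (a (j + 1)), f x = p j * x + q j}

/-- `f` is a least squares estimator over the class `F` for the sample
`(x i, y i)`, `i = 0, …, n-1`. -/
def IsLSE {α : Type*} (F : Set (α → ℝ)) (n : ℕ) (x : ℕ → α) (y : ℕ → ℝ) (f : α → ℝ) : Prop :=
  f ∈ F ∧ ∀ g ∈ F,
    ∑ i ∈ Finset.range n, (y i - f (x i)) ^ 2 ≤ ∑ i ∈ Finset.range n, (y i - g (x i)) ^ 2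

/-- canonical (left-continuous, piecewise constant with jumps at the design points)
structure for the isotonic LSE. -/
def IsoCanonical (n : ℕ) (x : ℕ → ℝ) (f : ℝ → ℝ) : Prop :=
  ∀ u v : ℝ, u ∈ Set.Icc (0 : ℝ) 1 → v ∈ Set.Icc (0 : ℝ) 1 → u ≤ v →
    (∀ i < n, x i ∉ Set.Ico u v) → f u = f v

/-- canonical (piecewise linear with kinks at the design points) structure for the convex LSE. -/
def ConvCanonical (n : ℕ) (x : ℕ → ℝ) (f : ℝ → ℝ) : Prop :=
  ∀ u v : ℝ, u ∈ Set.Icc (0 : ℝ) 1 → v ∈ Set.Icc (0 : ℝ) 1 → u ≤ v →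
    (∀ i < n, x i ∉ Set.Ioo u v) →
    ∀ t ∈ Set.Icc (0 : ℝ) 1, f ((1 - t) * u + t * v) = (1 - t) * f u + t * f v

/-- The Rademacher law on `ℝ`. -/
def radLaw : Measure ℝ := (2⁻¹ : ℝ≥0∞) • Measure.dirac 1 + (2⁻¹ : ℝ≥0∞) • Measure.dirac (-1)

/-- A tree system of intervals used in the lower bound construction: at level `l ≥ 1` there are
`2^l` intervals of length `(2^{1/(1-γ)})^{-l}` inside `[0,1]`, each level-(l+1) interval being
contained in a level-`l` interval. -/
def IsTreeSystem (γ : ℝ) (C : ℕ → Finset (Set ℝ)) : Prop :=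
  (∀ l, 1 ≤ l → (C l).card = 2 ^ l) ∧
  (∀ l, 1 ≤ l → ∀ I ∈ C l, ∃ a : ℝ,
      0 ≤ a ∧ a + (((2 : ℝ) ^ ((1 : ℝ) / (1 - γ)))⁻¹) ^ l ≤ 1 ∧
      I = Set.Icc a (a + (((2 : ℝ) ^ ((1 : ℝ) / (1 - γ)))⁻¹) ^ l)) ∧
  (∀ l, 1 ≤ l → ∀ I ∈ C (l + 1), ∃ J ∈ C l, I ⊆ J)

/-- The class of indicator functions attached to a tree system, together with `0`. -/
def treeClass (C : ℕ → Finset (Set ℝ)) : Set (ℝ → ℝ) :=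
  insert (fun _ => 0)
    {f | ∃ l, 1 ≤ l ∧ ∃ I ∈ C l, f = Set.indicator I (fun _ => (1 : ℝ))}

/-- The chain of indicators `1_{[0,δ]}`, `δ ∈ [0,1]` (the case `γ = 1`). -/
def chainClass : Set (ℝ → ℝ) :=
  {f | ∃ d ∈ Set.Icc (0 : ℝ) 1, f = Set.indicator (Set.Icc 0 d) (fun _ => (1 : ℝ))}

/-- `F` is a tree-structured class with envelope exponent `γ`. -/
def TreeModel (γ : ℝ) (F : Set (ℝ → ℝ)) : Prop :=
  (γ < 1 ∧ ∃ C : ℕ → Finset (Set ℝ), IsTreeSystem γ C ∧ F = treeClass C) ∨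
  (γ = 1 ∧ F = chainClass)

/-- `G` is a basic adaptive subset of `F`. -/
def IsBasicAdaptive (F G : Set (ℝ → ℝ)) : Prop :=
  G ⊆ F ∧ ∀ f ∈ F, ∀ g ∈ G, (f - g) ∈ F

/-- `Gm` is an `m`-th order adaptive subset of `F` relative to the basic adaptive subset `G`. -/
def IsAdaptiveSubset (F G : Set (ℝ → ℝ)) (m : ℕ) (Gm : Set (ℝ → ℝ)) : Prop :=
  ∀ gm ∈ Gm, gm ∈ F ∧ ∃ a : ℕ → ℝ, a 0 = 0 ∧ a m = 1 ∧ Monotone a ∧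
    ∃ gt : ℕ → ℝ → ℝ, (∀ j < m, gt j ∈ G) ∧
      ∀ j < m, ∀ x ∈ Set.Ioc (a j) (a (j + 1)), gm x = gt j x

/-- `F` satisfies a convexity-based shape constraint under `P`. -/
def ConvexityShape (P : Measure ℝ) (F : Set (ℝ → ℝ)) : Prop :=
  Convex ℝ F ∧ ∀ δ : ℝ, 0 < δ → ∃ Fδ : ℝ → ℝ,
    ConvexOn ℝ (Set.Icc 0 1) Fδ ∧
    ∀ f ∈ F, (∫ x, f x ^ 2 ∂P) ≤ δ ^ 2 → ∀ x ∈ Set.Icc (0 : ℝ) 1, |f x| ≤ Fδ x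


section pairIndep
variable {Ω : Type} [MeasurableSpace Ω] {μ : Measure Ω} [IsProbabilityMeasure μ]
  {ν P : Measure ℝ} {X ξ : ℕ → Ω → ℝ}

lemma aux_comp_int {Q : Measure ℝ} {Z : Ω → ℝ} (hZ : Measurable Z) (hmap : Measure.map Z μ = Q)
    {f : ℝ → ℝ} (hf : Measurable f) (hfi : Integrable f Q) :
    Integrable (fun ω => f (Z ω)) μ ∧ ∫ ω, f (Z ω) ∂μ = ∫ x, f x ∂Q := by
  subst hmap
  refine ⟨hfi.comp_measurable hZ, ?_⟩
  rw [integral_map hZ.aemeasurable hf.aestronglyMeasurable]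

lemma aux_prod2 (hX : ∀ i, Measurable (X i)) (hξ : ∀ i, Measurable (ξ i))
    (hXP : ∀ i, Measure.map (X i) μ = P) (hξν : ∀ i, Measure.map (ξ i) μ = ν)
    (hI : IndepFun (fun ω i => X i ω) (fun ω i => ξ i ω) μ) (i : ℕ)
    {f g : ℝ → ℝ} (hf : Measurable f) (hg : Measurable g)
    (hfi : Integrable f P) (hgi : Integrable g ν) :
    Integrable (fun ω => f (X i ω) * g (ξ i ω)) μ ∧
      ∫ ω, f (X i ω) * g (ξ i ω) ∂μ = (∫ x, f x ∂P) * ∫ x, g x ∂ν := by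
  obtain ⟨a1, a2⟩ := aux_comp_int (hX i) (hXP i) hf hfi
  obtain ⟨b1, b2⟩ := aux_comp_int (hξ i) (hξν i) hg hgi
  have h : IndepFun (fun ω => f (X i ω)) (fun ω => g (ξ i ω)) μ :=
    hI.comp (φ := fun x : ℕ → ℝ => f (x i)) (ψ := fun x : ℕ → ℝ => g (x i))
      (hf.comp (measurable_pi_apply i)) (hg.comp (measurable_pi_apply i))
  refine ⟨h.integrable_mul a1 b1, ?_⟩
  rw [h.integral_fun_mul_eq_mul_integral a1.1 b1.1, a2, b2]

lemma aux_prod4 (hX : ∀ i, Measurable (X i)) (hξ : ∀ i, Measurable (ξ i))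
    (hXP : ∀ i, Measure.map (X i) μ = P) (hξν : ∀ i, Measure.map (ξ i) μ = ν)
    (hXI : iIndepFun X μ) (hξI : iIndepFun ξ μ)
    (hI : IndepFun (fun ω i => X i ω) (fun ω i => ξ i ω) μ) {i j : ℕ} (hij : i ≠ j)
    {f f' g g' : ℝ → ℝ} (hf : Measurable f) (hg : Measurable g)
    (hf' : Measurable f') (hg' : Measurable g')
    (hfi : Integrable f P) (hgi : Integrable g ν)
    (hfi' : Integrable f' P) (hgi' : Integrable g' ν) :
    Integrable (fun ω => (f (X i ω) * f' (X j ω)) * (g (ξ i ω) * g' (ξ j ω))) μ ∧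
      ∫ ω, (f (X i ω) * f' (X j ω)) * (g (ξ i ω) * g' (ξ j ω)) ∂μ =
        ((∫ x, f x ∂P) * ∫ x, f' x ∂P) * ((∫ x, g x ∂ν) * ∫ x, g' x ∂ν) := by
  obtain ⟨a1, a2⟩ := aux_comp_int (hX i) (hXP i) hf hfi
  obtain ⟨b1, b2⟩ := aux_comp_int (hξ i) (hξν i) hg hgi
  obtain ⟨a1', a2'⟩ := aux_comp_int (hX j) (hXP j) hf' hfi'
  obtain ⟨b1', b2'⟩ := aux_comp_int (hξ j) (hξν j) hg' hgi'
  have h1 : IndepFun (fun ω => f (X i ω)) (fun ω => f' (X j ω)) μ :=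
    (hXI.indepFun hij).comp hf hf'
  have h2 : IndepFun (fun ω => g (ξ i ω)) (fun ω => g' (ξ j ω)) μ :=
    (hξI.indepFun hij).comp hg hg'
  have h : IndepFun (fun ω => f (X i ω) * f' (X j ω)) (fun ω => g (ξ i ω) * g' (ξ j ω)) μ :=
    hI.comp (φ := fun x : ℕ → ℝ => f (x i) * f' (x j)) (ψ := fun x : ℕ → ℝ => g (x i) * g' (x j))
      ((hf.comp (measurable_pi_apply i)).mul (hf'.comp (measurable_pi_apply j)))
      ((hg.comp (measurable_pi_apply i)).mul (hg'.comp (measurable_pi_apply j)))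
  have c1 : Integrable (fun ω => f (X i ω) * f' (X j ω)) μ := h1.integrable_mul a1 a1'
  have c2 : Integrable (fun ω => g (ξ i ω) * g' (ξ j ω)) μ := h2.integrable_mul b1 b1'
  refine ⟨h.integrable_mul c1 c2, ?_⟩
  rw [h.integral_fun_mul_eq_mul_integral c1.1 c2.1, h1.integral_fun_mul_eq_mul_integral a1.1 a1'.1,
    h2.integral_fun_mul_eq_mul_integral b1.1 b1'.1, a2, b2, a2', b2']

end pairIndep

/-! ### The symmetric Pareto law -/

def parR (b : ℝ) : Measure ℝ :=
  (volume.restrict (Ioi (1:ℝ))).withDensity (fun x => ENNReal.ofReal (b * x ^ (-b - 1)))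

lemma parR_integral (b : ℝ) (hb : 0 < b) (f : ℝ → ℝ) :
    ∫ x, f x ∂(parR b) = ∫ x in Ioi (1:ℝ), (b * x ^ (-b - 1)) * f x := by
  unfold parR
  rw [integral_withDensity_eq_integral_toReal_smul (by fun_prop) (by simp)]
  refine setIntegral_congr_fun measurableSet_Ioi fun x hx => ?_
  have : 0 < x := lt_trans one_pos hx
  simp only [smul_eq_mul]
  rw [ENNReal.toReal_ofReal (by positivity)]

lemma parR_integrable_iff (b : ℝ) (hb : 0 < b) (f : ℝ → ℝ) :
    Integrable f (parR b) ↔ IntegrableOn (fun x => (b * x ^ (-b - 1)) * f x) (Ioi 1) := by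
  unfold parR
  rw [integrable_withDensity_iff_integrable_smul' (by fun_prop) (by simp)]
  refine integrableOn_congr_fun (fun x hx => ?_) measurableSet_Ioi
  have : 0 < x := lt_trans one_pos hx
  simp only [smul_eq_mul]
  rw [ENNReal.toReal_ofReal (by positivity)]

lemma parR_prob (b : ℝ) (hb : 0 < b) : IsProbabilityMeasure (parR b) := by
  constructor
  unfold parR
  rw [withDensity_apply _ MeasurableSet.univ, Measure.restrict_univ,
    ← ofReal_integral_eq_lintegral_ofReal]
  · rw [integral_const_mul, integral_Ioi_rpow_of_lt (by linarith) one_pos]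
    simp
    field_simp
  · exact (integrableOn_Ioi_rpow_of_lt (by linarith) one_pos).const_mul b
  · refine (ae_restrict_iff' measurableSet_Ioi).2 (Filter.Eventually.of_forall fun x hx => ?_)
    have : 0 < x := lt_trans one_pos hx
    simp only [Pi.zero_apply]
    positivity

lemma parR_ae (b : ℝ) : ∀ᵐ x ∂(parR b), 1 < x := by
  unfold parR
  refine (withDensity_absolutelyContinuous _ _).ae_le ?_
  exact ae_restrict_mem measurableSet_Ioi

lemma parR_tail (b : ℝ) (hb : 0 < b) (t : ℝ) (ht : 1 ≤ t) :
    (parR b).real (Ici t) = t ^ (-b) := by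
  have h0 : 0 < t := by linarith
  rw [← integral_indicator_one measurableSet_Ici, parR_integral b hb]
  have : ∀ x, (b * x ^ (-b - 1)) * (Ici t).indicator (1 : ℝ → ℝ) x =
      (Ici t).indicator (fun x => b * x ^ (-b - 1)) x := by
    intro x; by_cases hx : x ∈ Ici t <;> simp [hx]
  simp_rw [this]
  rw [setIntegral_indicator measurableSet_Ici]
  have e : ∫ x in Ioi (1:ℝ) ∩ Ici t, b * x ^ (-b - 1) = ∫ x in Ioi t, b * x ^ (-b - 1) := by
    rcases eq_or_lt_of_le ht with h | h
    · subst h; congr 2; ext x; simp; exact fun h => h.le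
    · rw [Set.inter_eq_right.2 (Set.Ici_subset_Ioi.2 h), integral_Ici_eq_integral_Ioi]
  rw [e, integral_const_mul, integral_Ioi_rpow_of_lt (by linarith) h0]
  ring_nf
  field_simp

lemma parR_trunc (b : ℝ) (hb : 0 < b) (hb2 : b < 2) (A : ℝ) (hA : 1 ≤ A) :
    ∫ x, (if |x| ≤ A then x else 0) ^ 2 ∂(parR b) ≤ b / (2 - b) * A ^ (2 - b) := by
  rw [parR_integral b hb]
  have h1 : ∫ x in Ioi (1:ℝ), (b * x ^ (-b - 1)) * (if |x| ≤ A then x else 0) ^ 2 =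
      ∫ x in Ioi (1:ℝ), (Iic A).indicator (fun x => b * x ^ (1 - b)) x := by
    refine setIntegral_congr_fun measurableSet_Ioi fun x hx => ?_
    have h0 : 0 < x := lt_trans one_pos hx
    have : x ^ (1 - b) = x ^ (-b - 1) * x ^ 2 := by
      rw [← Real.rpow_natCast x 2, ← Real.rpow_add h0]; congr 1; push_cast; ring
    by_cases hxA : x ≤ A
    · simp [abs_of_pos h0, hxA, this]; ring
    · simp [abs_of_pos h0, hxA]
  rw [h1, setIntegral_indicator measurableSet_Iic, Ioi_inter_Iic, 
    ← intervalIntegral.integral_of_le hA, intervalIntegral.integral_const_mul,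
    integral_rpow (Or.inl (by linarith))]
  have : 1 - b + 1 = 2 - b := by ring
  rw [this, Real.one_rpow]
  have : 0 < 2 - b := by linarith
  rw [div_mul_eq_mul_div, mul_div_assoc']
  gcongr
  linarith

def parS (b : ℝ) : Measure ℝ :=
  (2⁻¹ : ℝ≥0∞) • parR b + (2⁻¹ : ℝ≥0∞) • (parR b).map (fun x => -x)

lemma parS_prob (b : ℝ) (hb : 0 < b) : IsProbabilityMeasure (parS b) := by
  have := parR_prob b hb
  constructor
  unfold parS
  rw [Measure.add_apply, Measure.smul_apply, Measure.smul_apply,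
    Measure.map_apply measurable_neg MeasurableSet.univ]
  simp [ENNReal.inv_two_add_inv_two]

lemma parS_integrable (b : ℝ) {f : ℝ → ℝ} (hf : Integrable f (parR b))
    (hf' : Integrable (fun x => f (-x)) (parR b)) : Integrable f (parS b) := by
  unfold parS
  refine Integrable.add_measure (hf.smul_measure (by simp)) (Integrable.smul_measure ?_ (by simp))
  exact (MeasurableEquiv.neg ℝ).measurableEmbedding.integrable_map_iff.2 hf'

lemma parS_integral (b : ℝ) {f : ℝ → ℝ} (hf : Integrable f (parR b))
    (hf' : Integrable (fun x => f (-x)) (parR b)) :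
    ∫ x, f x ∂(parS b) = (∫ x, f x ∂(parR b) + ∫ x, f (-x) ∂(parR b)) / 2 := by
  have e : ∫ x, f x ∂((parR b).map (fun x => -x)) = ∫ x, f (-x) ∂(parR b) :=
    (MeasurableEquiv.neg ℝ).measurableEmbedding.integral_map f
  unfold parS
  rw [integral_add_measure (hf.smul_measure (by simp)), integral_smul_measure, integral_smul_measure,
    e]
  · simp; ring
  · exact Integrable.smul_measure
      ((MeasurableEquiv.neg ℝ).measurableEmbedding.integrable_map_iff.2 hf') (by simp)

lemma parR_pow_int (b s : ℝ) (hb : 0 < b) (hs : s < b) :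
    Integrable (fun x => |x| ^ s) (parR b) := by
  rw [parR_integrable_iff b hb]
  have : IntegrableOn (fun x : ℝ => b * x ^ (s - b - 1)) (Ioi 1) :=
    (integrableOn_Ioi_rpow_of_lt (by linarith) one_pos).const_mul b
  refine this.congr_fun (fun x hx => ?_) measurableSet_Ioi
  have h0 : 0 < x := lt_trans one_pos hx
  simp only
  rw [abs_of_pos h0, mul_assoc, ← Real.rpow_add h0]
  congr 2; ring

lemma parS_all (b : ℝ) (hb1 : 1 < b) (hb2 : b < 2) :
    IsProbabilityMeasure (parS b) ∧ Integrable (fun x : ℝ => x) (parS b) ∧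
    (∫ x, x ∂(parS b)) = 0 ∧
    (∀ s, s < b → Integrable (fun x : ℝ => |x| ^ s) (parS b)) ∧
    (∀ A, ∫ x, (if |x| ≤ A then x else 0) ∂(parS b) = 0) ∧
    (∀ A, 1 ≤ A → ∫ x, (if |x| ≤ A then x else 0) ^ 2 ∂(parS b) ≤ b / (2 - b) * A ^ (2 - b)) ∧
    (∀ t, 1 ≤ t → (parS b).real (Ici t) = t ^ (-b) / 2) ∧
    (∀ t, 1 ≤ t → (parS b).real {x | t < |x|} ≤ t ^ (-b)) := by
  have hb : 0 < b := by linarith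
  have := parR_prob b hb
  have := parS_prob b hb
  have hid : Integrable (fun x : ℝ => x) (parR b) := by
    have := parR_pow_int b 1 hb hb1
    simp only [Real.rpow_one] at this
    exact (integrable_norm_iff (by fun_prop)).1 this
  have hmeas : ∀ A : ℝ, Measurable (fun x : ℝ => if |x| ≤ A then x else 0) := fun A =>
    Measurable.ite (measurableSet_le (by fun_prop) (by fun_prop)) measurable_id measurable_const
  have hti : ∀ A : ℝ, Integrable (fun x : ℝ => if |x| ≤ A then x else 0) (parR b) := fun A => by
    refine hid.mono (hmeas A).aestronglyMeasurable (Filter.Eventually.of_forall fun x => ?_)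
    split_ifs <;> simp
  have hti2 : ∀ A : ℝ, Integrable (fun x : ℝ => (if |x| ≤ A then x else 0) ^ 2) (parR b) :=
    fun A => by
    refine (integrable_const (A ^ 2)).mono ((hmeas A).pow_const 2).aestronglyMeasurable
      (Filter.Eventually.of_forall fun x => ?_)
    split_ifs with h
    · simp only [norm_pow, Real.norm_eq_abs]
      exact pow_le_pow_left₀ (abs_nonneg _) (h.trans (le_abs_self A)) 2
    · simp; positivity
  have hn : ∀ A x : ℝ, (if |-x| ≤ A then -x else 0) = -(if |x| ≤ A then x else 0) := by
    intro A x; rw [abs_neg]; split_ifs <;> simp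
  refine ⟨inferInstance, parS_integrable b hid hid.neg, ?_, ?_, ?_, ?_, ?_, ?_⟩
  · rw [parS_integral b hid hid.neg, integral_neg]; simp
  · intro s hs
    have := parR_pow_int b s hb hs
    exact parS_integrable b this (by simpa using this)
  · intro A
    rw [parS_integral b (hti A) (by simp_rw [hn]; exact (hti A).neg)]
    simp_rw [hn]
    rw [integral_neg]; simp
  · intro A hA
    rw [parS_integral b (hti2 A) (by simp_rw [hn, neg_sq]; exact (hti2 A))]
    simp_rw [hn, neg_sq]
    linarith [parR_trunc b hb hb2 A hA]
  · intro t ht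
    have i1 : Integrable ((Ici t).indicator (1 : ℝ → ℝ)) (parR b) :=
      (integrable_const 1).indicator measurableSet_Ici
    have z : (fun x => (Ici t).indicator (1 : ℝ → ℝ) (-x)) =ᵐ[parR b] 0 := by
      filter_upwards [parR_ae b] with x hx
      simp; linarith
    rw [← integral_indicator_one measurableSet_Ici,
      parS_integral b i1 ((integrable_zero _ _ _).congr z.symm), integral_congr_ae z,
      integral_indicator_one measurableSet_Ici, parR_tail b hb t ht]
    simp
  · intro t ht
    have hm : MeasurableSet {x : ℝ | t < |x|} := measurableSet_lt (by fun_prop) (by fun_prop)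
    have i1 : Integrable ({x : ℝ | t < |x|}.indicator (1 : ℝ → ℝ)) (parR b) :=
      (integrable_const 1).indicator hm
    have e : ∀ x, {x : ℝ | t < |x|}.indicator (1 : ℝ → ℝ) (-x) =
      {x : ℝ | t < |x|}.indicator (1 : ℝ → ℝ) x := by
      intro x; simp [indicator]
    rw [← integral_indicator_one hm, parS_integral b i1 (by simp_rw [e]; exact i1)]
    simp_rw [e]
    rw [integral_indicator_one hm, ← parR_tail b hb t ht]
    have : (parR b).real {x | t < |x|} ≤ (parR b).real (Ici t) := by
      refine ENNReal.toReal_mono (measure_ne_top _ _) (measure_mono_ae ?_)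
      filter_upwards [parR_ae b] with x hx h
      have h' : t < |x| := h
      rw [abs_of_pos (by linarith)] at h'
      exact h'.le
    linarith

/-! ### Probability estimates -/

structure RegS {Ω : Type} [MeasurableSpace Ω] (μ : Measure Ω) (P ν : Measure ℝ)
    (X ξ : ℕ → Ω → ℝ) : Prop where
  hX : ∀ i, Measurable (X i)
  hξ : ∀ i, Measurable (ξ i)
  hXP : ∀ i, Measure.map (X i) μ = P
  hξν : ∀ i, Measure.map (ξ i) μ = ν
  hXI : iIndepFun X μ
  hξI : iIndepFun ξ μ
  hI : IndepFun (fun ω i => X i ω) (fun ω i => ξ i ω) μ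

def oneI (S : Set ℝ) : ℝ → ℝ := S.indicator (fun _ => (1:ℝ))

lemma oneI_mem {S : Set ℝ} {x : ℝ} (h : x ∈ S) : oneI S x = 1 := by simp [oneI, h]
lemma oneI_not {S : Set ℝ} {x : ℝ} (h : x ∉ S) : oneI S x = 0 := by simp [oneI, h]
lemma oneI_nonneg (S : Set ℝ) (x : ℝ) : 0 ≤ oneI S x := by
  by_cases h : x ∈ S <;> simp [oneI, h]
lemma oneI_sq (S : Set ℝ) (x : ℝ) : oneI S x * oneI S x = oneI S x := by
  by_cases h : x ∈ S <;> simp [oneI, h]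
lemma oneI_meas {S : Set ℝ} (hS : MeasurableSet S) : Measurable (oneI S) :=
  measurable_const.indicator hS
lemma oneI_int {S : Set ℝ} (hS : MeasurableSet S) (Q : Measure ℝ) [IsProbabilityMeasure Q] :
    Integrable (oneI S) Q := (integrable_const 1).indicator hS
lemma oneI_integral {S : Set ℝ} (hS : MeasurableSet S) (Q : Measure ℝ) :
    ∫ x, oneI S x ∂Q = Q.real S := integral_indicator_one hS

section core
variable {Ω : Type} [MeasurableSpace Ω] {μ : Measure Ω} [IsProbabilityMeasure μ]
  {ν P : Measure ℝ} [IsProbabilityMeasure ν] [IsProbabilityMeasure P] {X ξ : ℕ → Ω → ℝ}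

lemma core_B (H : RegS μ P ν X ξ) (n : ℕ) {R T : Set ℝ} (hR : MeasurableSet R)
    (hT : MeasurableSet T) :
    n * (P.real R * ν.real T) - (n * (P.real R * ν.real T)) ^ 2 ≤
      μ.real {ω | ∃ i < n, X i ω ∈ R ∧ ξ i ω ∈ T} := by
  set q := P.real R * ν.real T with hq
  set B := {ω | ∃ i < n, X i ω ∈ R ∧ ξ i ω ∈ T} with hB
  have hBm : MeasurableSet B := by
    have : B = ⋃ i ∈ Finset.range n, (X i ⁻¹' R ∩ ξ i ⁻¹' T) := by
      ext ω; simp [hB]; tauto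
    rw [this]
    exact Finset.measurableSet_biUnion _ fun i _ => (H.hX i hR).inter (H.hξ i hT)
  let z : ℕ → Ω → ℝ := fun i ω => oneI R (X i ω) * oneI T (ξ i ω)
  have hz : ∀ i, Integrable (z i) μ ∧ ∫ ω, z i ω ∂μ = q := by
    intro i
    have := aux_prod2 H.hX H.hξ H.hXP H.hξν H.hI i (oneI_meas hR) (oneI_meas hT)
      (oneI_int hR P) (oneI_int hT ν)
    rwa [oneI_integral hR, oneI_integral hT] at this
  have hzz : ∀ i j, Integrable (fun ω => z i ω * z j ω) μ ∧
      ∫ ω, z i ω * z j ω ∂μ ≤ (if i = j then q else 0) + q ^ 2 := by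
    intro i j
    by_cases hij : i = j
    · subst hij
      have : (fun ω => z i ω * z i ω) = z i := by
        funext ω
        simp only [z]
        rw [mul_mul_mul_comm, oneI_sq, oneI_sq]
      simp only [if_true]
      rw [this, (hz i).2]
      exact ⟨(hz i).1, by nlinarith [sq_nonneg q]⟩
    · have := aux_prod4 H.hX H.hξ H.hXP H.hξν H.hXI H.hξI H.hI hij (oneI_meas hR) (oneI_meas hT)
        (oneI_meas hR) (oneI_meas hT) (oneI_int hR P) (oneI_int hT ν) (oneI_int hR P) (oneI_int hT ν)
      rw [oneI_integral hR, oneI_integral hT] at this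
      have e : (fun ω => z i ω * z j ω) = fun ω => (oneI R (X i ω) * oneI R (X j ω)) *
          (oneI T (ξ i ω) * oneI T (ξ j ω)) := by
        funext ω; simp only [z]; ring
      rw [e, this.2, if_neg hij]
      refine ⟨this.1, le_of_eq ?_⟩
      rw [hq]; ring
  have key : ∀ ω, 2 * (∑ i ∈ Finset.range n, z i ω) -
      ∑ i ∈ Finset.range n, ∑ j ∈ Finset.range n, z i ω * z j ω ≤ B.indicator 1 ω := by
    intro ω
    rw [← Finset.sum_mul_sum]
    by_cases h : ω ∈ B
    · simp only [h, indicator_of_mem, Pi.one_apply]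
      nlinarith [sq_nonneg ((∑ i ∈ Finset.range n, z i ω) - 1)]
    · have : ∑ i ∈ Finset.range n, z i ω = 0 := by
        refine Finset.sum_eq_zero fun i hi => ?_
        simp only [hB, mem_ofPred_eq, not_exists, not_and] at h
        have := h i (Finset.mem_range.1 hi)
        by_cases hx : X i ω ∈ R
        · simp only [z]; rw [oneI_not (this hx), mul_zero]
        · simp only [z]; rw [oneI_not hx, zero_mul]
      simp [this, h]
  have i1 : Integrable (fun ω => 2 * (∑ i ∈ Finset.range n, z i ω)) μ :=
    (integrable_finsetSum _ fun i _ => (hz i).1).const_mul 2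
  have i2 : Integrable (fun ω => ∑ i ∈ Finset.range n, ∑ j ∈ Finset.range n, z i ω * z j ω) μ :=
    integrable_finsetSum _ fun i _ => integrable_finsetSum _ fun j _ => (hzz i j).1
  have := integral_mono (i1.sub i2) ((integrable_const (1:ℝ)).indicator hBm) key
  have e0 : ∫ ω, B.indicator (fun _ => (1:ℝ)) ω ∂μ = μ.real B := integral_indicator_one hBm
  rw [e0] at this
  refine le_trans ?_ this
  simp only [Pi.sub_apply]
  rw [integral_sub i1 i2, integral_const_mul, integral_finsetSum _ fun i _ => (hz i).1,
    integral_finsetSum _ fun i _ => integrable_finsetSum _ fun j _ => (hzz i j).1]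
  have e1 : ∑ i ∈ Finset.range n, ∫ ω, z i ω ∂μ = n * q := by
    rw [Finset.sum_congr rfl fun i _ => (hz i).2]; simp
  have e2 : ∑ i ∈ Finset.range n, ∫ ω, ∑ j ∈ Finset.range n, z i ω * z j ω ∂μ ≤
      ∑ i ∈ Finset.range n, (q + n * q ^ 2) := by
    refine Finset.sum_le_sum fun i hi => ?_
    rw [integral_finsetSum _ fun j _ => (hzz i j).1]
    refine (Finset.sum_le_sum fun j _ => (hzz i j).2).trans (le_of_eq ?_)
    rw [Finset.sum_add_distrib, Finset.sum_ite_eq, if_pos hi]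
    simp
  rw [e1]
  simp only [Finset.sum_const, Finset.card_range, nsmul_eq_mul] at e2
  nlinarith

lemma core_C (H : RegS μ P ν X ξ) (n : ℕ) {I T : Set ℝ} (hI : MeasurableSet I)
    (hT : MeasurableSet T) (hint : Integrable (fun x : ℝ => x) ν) {A : ℝ} (hA : 0 < A) (i : ℕ) :
    μ.real {ω | X i ω ∈ I ∧ ξ i ω ∈ T ∧
        A ≤ ∑ j ∈ (Finset.range n).erase i, oneI I (X j ω) * (2 * |ξ j ω| + 1)} ≤
      n * P.real I ^ 2 * ν.real T * (∫ x, (2 * |x| + 1) ∂ν) / A := by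
  set C := ∫ x, (2 * |x| + 1) ∂ν with hC
  have hC0 : 0 ≤ C := integral_nonneg fun x => by positivity
  have hgi : Integrable (fun x : ℝ => 2 * |x| + 1) ν := (hint.abs.const_mul 2).add (integrable_const 1)
  let w : ℕ → Ω → ℝ := fun j ω => (oneI I (X i ω) * oneI I (X j ω)) *
          (oneI T (ξ i ω) * (2 * |ξ j ω| + 1))
  have hw : ∀ j ∈ (Finset.range n).erase i, Integrable (w j) μ ∧
      ∫ ω, w j ω ∂μ = P.real I ^ 2 * ν.real T * C := by
    intro j hj
    have := aux_prod4 H.hX H.hξ H.hXP H.hξν H.hXI H.hξI H.hI (Finset.ne_of_mem_erase hj).symm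
      (oneI_meas hI) (oneI_meas hT) (oneI_meas hI) (g' := fun x => 2 * |x| + 1) (by fun_prop)
      (oneI_int hI P) (oneI_int hT ν) (oneI_int hI P) hgi
    rw [oneI_integral hI, oneI_integral hT] at this
    refine ⟨this.1, this.2.trans ?_⟩
    rw [hC]; ring
  have hwn : ∀ j ω, 0 ≤ w j ω := fun j ω => by
    have := oneI_nonneg I (X i ω)
    have := oneI_nonneg I (X j ω)
    have := oneI_nonneg T (ξ i ω)
    positivity
  have m := mul_meas_ge_le_integral_of_nonneg (μ := μ)
    (f := fun ω => ∑ j ∈ (Finset.range n).erase i, w j ω)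
    (Filter.Eventually.of_forall fun ω => Finset.sum_nonneg fun j _ => hwn j ω)
    (integrable_finsetSum _ fun j hj => (hw j hj).1) A
  rw [integral_finsetSum _ fun j hj => (hw j hj).1, Finset.sum_congr rfl fun j hj => (hw j hj).2] at m
  rw [le_div_iff₀ hA, mul_comm]
  refine le_trans (mul_le_mul_of_nonneg_left (measureReal_mono ?_) hA.le) (m.trans ?_)
  · rintro ω ⟨h1, h2, h3⟩
    simp only [mem_ofPred_eq, w]
    refine h3.trans (le_of_eq (Finset.sum_congr rfl fun j _ => ?_))
    rw [oneI_mem h1, oneI_mem h2]; ring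
  · rw [Finset.sum_const, nsmul_eq_mul]
    have : (((Finset.range n).erase i).card : ℝ) ≤ n := by
      exact_mod_cast (Finset.card_erase_le).trans (by simp)
    have h0 : 0 ≤ P.real I ^ 2 * ν.real T * C := by positivity
    nlinarith

lemma core_D (H : RegS μ P ν X ξ) (n : ℕ) {I : Set ℝ} (hI : MeasurableSet I)
    {η : ℝ → ℝ} (hη : Measurable η) (h1 : Integrable η ν) (h2 : Integrable (fun x => η x ^ 2) ν)
    (h0 : ∫ x, η x ∂ν = 0) {A : ℝ} (hA : 0 < A) :
    μ.real {ω | A ≤ ∑ j ∈ Finset.range n, oneI I (X j ω) * η (ξ j ω)} ≤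
      n * P.real I * (∫ x, η x ^ 2 ∂ν) / A ^ 2 := by
  set v := ∫ x, η x ^ 2 ∂ν with hv
  let z : ℕ → Ω → ℝ := fun i ω => oneI I (X i ω) * η (ξ i ω)
  have hzz : ∀ i j, Integrable (fun ω => z i ω * z j ω) μ ∧
      ∫ ω, z i ω * z j ω ∂μ = (if i = j then P.real I * v else 0) := by
    intro i j
    by_cases hij : i = j
    · subst hij
      have e : (fun ω => z i ω * z i ω) = fun ω => oneI I (X i ω) * (fun x => η x ^ 2) (ξ i ω) := by
        funext ω
        simp only [z]
        rw [mul_mul_mul_comm, oneI_sq, sq]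
      simp only [if_true]
      have := aux_prod2 H.hX H.hξ H.hXP H.hξν H.hI i (oneI_meas hI) (hη.pow_const 2)
        (oneI_int hI P) h2
      rw [oneI_integral hI] at this
      rw [e]; exact this
    · have := aux_prod4 H.hX H.hξ H.hXP H.hξν H.hXI H.hξI H.hI hij (oneI_meas hI) hη
        (oneI_meas hI) hη (oneI_int hI P) h1 (oneI_int hI P) h1
      have e : (fun ω => z i ω * z j ω) = fun ω => (oneI I (X i ω) * oneI I (X j ω)) *
          (η (ξ i ω) * η (ξ j ω)) := by
        funext ω; simp only [z]; ring
      rw [e, this.2, if_neg hij]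
      exact ⟨this.1, by rw [h0]; ring⟩
  have m := mul_meas_ge_le_integral_of_nonneg (μ := μ)
    (f := fun ω => ∑ i ∈ Finset.range n, ∑ j ∈ Finset.range n, z i ω * z j ω)
    (Filter.Eventually.of_forall fun ω => by
      simp only [Pi.zero_apply]
      rw [← Finset.sum_mul_sum]; exact mul_self_nonneg _)
    (integrable_finsetSum _ fun i _ => integrable_finsetSum _ fun j _ => (hzz i j).1) (A ^ 2)
  rw [integral_finsetSum _ fun i _ => integrable_finsetSum _ fun j _ => (hzz i j).1] at m
  rw [le_div_iff₀ (by positivity), mul_comm]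
  refine le_trans (mul_le_mul_of_nonneg_left (measureReal_mono ?_) (by positivity))
    (m.trans (le_of_eq ?_))
  · intro ω h
    simp only [mem_ofPred_eq] at h ⊢
    rw [← Finset.sum_mul_sum, ← sq]
    exact pow_le_pow_left₀ hA.le h 2
  · have : ∀ i ∈ Finset.range n, ∫ ω, ∑ j ∈ Finset.range n, z i ω * z j ω ∂μ = P.real I * v := by
      intro i hi
      rw [integral_finsetSum _ fun j _ => (hzz i j).1, Finset.sum_congr rfl fun j _ => (hzz i j).2,
        Finset.sum_ite_eq, if_pos hi]
    rw [Finset.sum_congr rfl this]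
    simp; ring

lemma core_D_all (H : RegS μ P ν X ξ) (n : ℕ) {ι : Type} [Countable ι] {J : ι → Set ℝ}
    (hJ : ∀ k, MeasurableSet (J k)) (hdis : Pairwise (Function.onFun Disjoint J)) {D : Set ℝ}
    (hD : MeasurableSet D) (hJD : ∀ k, J k ⊆ D) {A : ℝ} (hA : 0 < A)
    (h0 : ∫ x, (if |x| ≤ A then x else 0) ∂ν = 0) :
    μ.real {ω | ∃ k, A ≤ ∑ j ∈ Finset.range n, oneI (J k) (X j ω) * ξ j ω} ≤
      n * P.real D * (ν.real {x | A < |x|} +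
        (∫ x, (if |x| ≤ A then x else 0) ^ 2 ∂ν) / A ^ 2) := by
  set η : ℝ → ℝ := fun x => if |x| ≤ A then x else 0 with hηd
  have hη : Measurable η :=
    Measurable.ite (measurableSet_le (by fun_prop) (by fun_prop)) measurable_id measurable_const
  have hb : ∀ x, |η x| ≤ A := by
    intro x; simp only [hηd]; split_ifs with h
    · exact h
    · simpa using hA.le
  have h1 : Integrable η ν := (integrable_const A).mono' hη.aestronglyMeasurable
    (Filter.Eventually.of_forall fun x => hb x)
  have h2 : Integrable (fun x => η x ^ 2) ν :=
    (integrable_const (A ^ 2)).mono' (hη.pow_const 2).aestronglyMeasurable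
    (Filter.Eventually.of_forall fun x => by
      simp only [norm_pow, Real.norm_eq_abs]
      exact pow_le_pow_left₀ (abs_nonneg _) (hb x) 2)
  change _ ≤ n * P.real D * (_ + (∫ x, η x ^ 2 ∂ν) / A ^ 2)
  set v := ∫ x, η x ^ 2 ∂ν with hv
  have hv0 : 0 ≤ v := integral_nonneg fun x => by positivity
  set T := {x : ℝ | A < |x|} with hT
  have hTm : MeasurableSet T := measurableSet_lt (by fun_prop) (by fun_prop)
  have hsub : {ω | ∃ k, A ≤ ∑ j ∈ Finset.range n, oneI (J k) (X j ω) * ξ j ω} ⊆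
      (⋃ i ∈ Finset.range n, (X i ⁻¹' D ∩ ξ i ⁻¹' T)) ∪
      ⋃ k, {ω | A ≤ ∑ j ∈ Finset.range n, oneI (J k) (X j ω) * η (ξ j ω)} := by
    rintro ω ⟨k, hk⟩
    by_cases h : ω ∈ ⋃ i ∈ Finset.range n, (X i ⁻¹' D ∩ ξ i ⁻¹' T)
    · exact Or.inl h
    · right
      refine mem_iUnion.2 ⟨k, ?_⟩
      simp only [mem_ofPred_eq]
      refine hk.trans (le_of_eq (Finset.sum_congr rfl fun j hj => ?_))
      by_cases hx : X j ω ∈ J k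
      · have : ξ j ω ∉ T := fun hh => h (mem_biUnion (by simpa using hj) ⟨hJD k hx, hh⟩)
        have h' : |ξ j ω| ≤ A := by simpa [hT] using this
        simp [hηd, h']
      · rw [oneI_not hx]; ring
  refine (measureReal_mono hsub).trans ((measureReal_union_le _ _).trans ?_)
  rw [mul_add]
  refine add_le_add ?_ ?_
  · refine (measureReal_biUnion_finset_le _ _).trans ?_
    have : ∀ i ∈ Finset.range n, μ.real (X i ⁻¹' D ∩ ξ i ⁻¹' T) = P.real D * ν.real T := by
      intro i _
      have := aux_prod2 H.hX H.hξ H.hXP H.hξν H.hI i (oneI_meas hD) (oneI_meas hTm)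
        (oneI_int hD P) (oneI_int hTm ν)
      rw [oneI_integral hD, oneI_integral hTm] at this
      rw [← this.2, ← integral_indicator_one ((H.hX i hD).inter (H.hξ i hTm))]
      congr 1; funext ω
      by_cases hx : X i ω ∈ D <;> by_cases hy : ξ i ω ∈ T <;> simp [oneI, hx, hy]
    rw [Finset.sum_congr rfl this]
    simp; rw [mul_assoc]
  · have hk : ∀ k, μ {ω | A ≤ ∑ j ∈ Finset.range n, oneI (J k) (X j ω) * η (ξ j ω)} ≤
        ENNReal.ofReal (n * v / A ^ 2) * P (J k) := by
      intro k
      have := core_D H n (hJ k) hη h1 h2 h0 hA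
      rw [← ofReal_measureReal (μ := μ), ← ofReal_measureReal (μ := P),
        ← ENNReal.ofReal_mul (by positivity)]
      refine ENNReal.ofReal_le_ofReal (this.trans (le_of_eq ?_))
      rw [← hv]; ring
    have : μ (⋃ k, {ω | A ≤ ∑ j ∈ Finset.range n, oneI (J k) (X j ω) * η (ξ j ω)}) ≤
        ENNReal.ofReal (n * v / A ^ 2) * P D := by
      refine (measure_iUnion_le _).trans ((ENNReal.tsum_le_tsum hk).trans ?_)
      rw [ENNReal.tsum_mul_left, ← measure_iUnion hdis hJ]
      gcongr
      exact iUnion_subset hJD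
    refine (ENNReal.toReal_mono (ENNReal.mul_ne_top ENNReal.ofReal_ne_top (measure_ne_top _ _))
      this).trans (le_of_eq ?_)
    rw [ENNReal.toReal_mul, ENNReal.toReal_ofReal (by positivity), ← measureReal_def]
    ring

lemma core_main (H : RegS μ P ν X ξ) (n N : ℕ) {ι : Type} [Countable ι] {J : ι → Set ℝ}
    (hJ : ∀ k, MeasurableSet (J k)) (hdis : Pairwise (Function.onFun Disjoint J)) {D : Set ℝ}
    (hD : MeasurableSet D) (hJD : ∀ k, J k ⊆ D)
    {I : Fin N → Set ℝ} (hI : ∀ k, MeasurableSet (I k))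
    (hIdis : Pairwise (Function.onFun Disjoint I)) {L : ℝ} (hL : ∀ k, P.real (I k) = L)
    {A : ℝ} (hA : 1 ≤ A) (hint : Integrable (fun x : ℝ => x) ν)
    (h0 : ∫ x, (if |x| ≤ A then x else 0) ∂ν = 0) {θ : ℝ}
    (hθ : θ = n * (N * L * ν.real (Ici (3 * A)))) :
    θ - θ ^ 2 - θ * (n * L * (∫ x, (2 * |x| + 1) ∂ν) / A) -
      n * P.real D * (ν.real {x | A < |x|} +
        (∫ x, (if |x| ≤ A then x else 0) ^ 2 ∂ν) / A ^ 2) ≤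
    μ.real {ω | (∃ k, 4 * A ≤ ∑ j ∈ Finset.range n, oneI (I k) (X j ω) * (2 * ξ j ω - 1)) ∧
      ∀ k, ∑ j ∈ Finset.range n, oneI (J k) (X j ω) * ξ j ω < A} := by
  have hA0 : 0 < A := by linarith
  set G := {ω | (∃ k, 4 * A ≤ ∑ j ∈ Finset.range n, oneI (I k) (X j ω) * (2 * ξ j ω - 1)) ∧
      ∀ k, ∑ j ∈ Finset.range n, oneI (J k) (X j ω) * ξ j ω < A} with hG
  set T := Ici (3 * A) with hT
  have hTm : MeasurableSet T := measurableSet_Ici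
  set R := ⋃ k, I k with hR
  have hRm : MeasurableSet R := MeasurableSet.iUnion hI
  have hPR : P.real R = N * L := by
    rw [hR, measureReal_iUnion_fintype hIdis hI]
    simp [hL]
  have b := core_B H n hRm hTm
  rw [hPR, ← hθ] at b
  have d := core_D_all H n hJ hdis hD hJD hA0 h0
  set Dd := {ω | ∃ k, A ≤ ∑ j ∈ Finset.range n, oneI (J k) (X j ω) * ξ j ω}
  let Cc : ℕ × Fin N → Set Ω := fun p => {ω | X p.1 ω ∈ I p.2 ∧ ξ p.1 ω ∈ T ∧
        A ≤ ∑ j ∈ (Finset.range n).erase p.1, oneI (I p.2) (X j ω) * (2 * |ξ j ω| + 1)}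
  have c : μ.real (⋃ p ∈ Finset.range n ×ˢ (Finset.univ : Finset (Fin N)), Cc p) ≤
      θ * (n * L * (∫ x, (2 * |x| + 1) ∂ν) / A) := by
    refine (measureReal_biUnion_finset_le _ _).trans ?_
    refine (Finset.sum_le_sum fun p _ => core_C H n (hI p.2) hTm hint hA0 p.1).trans (le_of_eq ?_)
    simp only [hL, Finset.sum_const, Finset.card_product, Finset.card_range, Finset.card_univ,
      Fintype.card_fin, nsmul_eq_mul]
    rw [hθ]; push_cast; ring
  have hsub : {ω | ∃ i < n, X i ω ∈ R ∧ ξ i ω ∈ T} ⊆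
      (G ∪ ⋃ p ∈ Finset.range n ×ˢ (Finset.univ : Finset (Fin N)), Cc p) ∪ Dd := by
    rintro ω ⟨i, hi, hx, ht⟩
    obtain ⟨k, hk⟩ := mem_iUnion.1 hx
    by_cases hd : ω ∈ Dd
    · exact Or.inr hd
    left
    by_cases hc : ω ∈ Cc (i, k)
    · exact Or.inr (mem_biUnion (by simpa using hi) hc)
    left
    refine ⟨⟨k, ?_⟩, fun k' => ?_⟩
    · have h3 : ∑ j ∈ (Finset.range n).erase i, oneI (I k) (X j ω) * (2 * |ξ j ω| + 1) < A := by
        by_contra hh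
        exact hc ⟨hk, ht, not_lt.1 hh⟩
      rw [← Finset.add_sum_erase _ _ (Finset.mem_range.2 hi), oneI_mem hk]
      have h4 : -∑ j ∈ (Finset.range n).erase i, oneI (I k) (X j ω) * (2 * |ξ j ω| + 1) ≤
          ∑ j ∈ (Finset.range n).erase i, oneI (I k) (X j ω) * (2 * ξ j ω - 1) := by
        rw [← Finset.sum_neg_distrib]
        refine Finset.sum_le_sum fun j _ => ?_
        rw [← mul_neg]
        refine mul_le_mul_of_nonneg_left ?_ (oneI_nonneg _ _)
        linarith [neg_abs_le (ξ j ω)]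
      have : 3 * A ≤ ξ i ω := ht
      linarith
    · by_contra hh
      exact hd ⟨k', not_lt.1 hh⟩
  have := (measureReal_mono hsub (μ := μ)).trans ((measureReal_union_le _ _).trans
    (add_le_add_left (measureReal_union_le _ _) _))
  linarith

end core

/-! ### The class -/

def cN (γ : ℝ) (l : ℕ) : ℕ := ⌈(1/2 : ℝ) ^ l / ((1/2 : ℝ) ^ l) ^ (1/γ)⌉₊
def cL (γ : ℝ) (l : ℕ) : ℝ := (1/2 : ℝ) ^ (l+1) / cN γ l
def cellK (γ : ℝ) (l k : ℕ) : Set ℝ :=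
  Ioc ((1/2 : ℝ) ^ (l+1) + k * cL γ l) ((1/2 : ℝ) ^ (l+1) + (k + 1) * cL γ l)
abbrev cIdx (γ : ℝ) : Type := Σ l : ℕ, Fin (cN γ l)
def cellS (γ : ℝ) (s : cIdx γ) : Set ℝ := cellK γ s.1 s.2
def cF (γ : ℝ) : Set (ℝ → ℝ) := insert (fun _ => 0) (range fun s : cIdx γ => oneI (cellS γ s))

lemma cN_bound (γ : ℝ) (h0 : 0 < γ) (h1 : γ ≤ 1) (l : ℕ) :
    0 < (cN γ l : ℝ) ∧ ((1/2 : ℝ) ^ l) ^ (1/γ) / 4 ≤ cL γ l ∧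
      cL γ l ≤ ((1/2 : ℝ) ^ l) ^ (1/γ) / 2 ∧ cN γ l * cL γ l = (1/2 : ℝ) ^ (l+1) := by
  set w := (1/2 : ℝ) ^ l with hw
  have w0 : 0 < w := by positivity
  have w1 : w ≤ 1 := pow_le_one₀ (by norm_num) (by norm_num)
  have hle : w ^ (1/γ) ≤ w := by
    conv_rhs => rw [← Real.rpow_one w]
    exact Real.rpow_le_rpow_of_exponent_ge w0 w1 ((one_le_div h0).2 h1)
  have hp : 0 < w ^ (1/γ) := by positivity
  have q1 : 1 ≤ w / w ^ (1/γ) := (one_le_div hp).2 hle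
  have n1 : w / w ^ (1/γ) ≤ cN γ l := Nat.le_ceil _
  have n2 : (cN γ l : ℝ) < w / w ^ (1/γ) + 1 := Nat.ceil_lt_add_one (by positivity)
  have n0 : 0 < (cN γ l : ℝ) := by linarith
  have hLw : cL γ l = w / 2 / cN γ l := by unfold cL; rw [pow_succ, ← hw]; ring
  refine ⟨n0, ?_, ?_, ?_⟩
  · rw [hLw, le_div_iff₀ n0]
    have : (cN γ l : ℝ) ≤ 2 * (w / w ^ (1/γ)) := by linarith
    calc w ^ (1/γ) / 4 * cN γ l ≤ w ^ (1/γ) / 4 * (2 * (w / w ^ (1/γ))) := by gcongr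
      _ = w / 2 := by field_simp; norm_num
  · rw [hLw, div_le_iff₀ n0]
    calc w / 2 = w ^ (1/γ) / 2 * (w / w ^ (1/γ)) := by field_simp
      _ ≤ _ := by gcongr
  · unfold cL; field_simp

lemma cell_sub (γ : ℝ) (h0 : 0 < γ) (h1 : γ ≤ 1) (s : cIdx γ) :
    cellS γ s ⊆ Ioc ((1/2 : ℝ) ^ (s.1+1)) ((1/2 : ℝ) ^ s.1) := by
  obtain ⟨a, b, c, d⟩ := cN_bound γ h0 h1 s.1
  have hL : 0 < cL γ s.1 := lt_of_lt_of_le (by positivity) b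
  rintro x ⟨hx1, hx2⟩
  have hk : ((s.2 : ℕ) : ℝ) + 1 ≤ cN γ s.1 := by exact_mod_cast s.2.2
  have hk0 : (0:ℝ) ≤ ((s.2 : ℕ) : ℝ) := by positivity
  refine ⟨?_, ?_⟩
  · nlinarith
  · have : (1/2 : ℝ) ^ s.1 = (1/2 : ℝ) ^ (s.1+1) + (1/2 : ℝ) ^ (s.1+1) := by rw [pow_succ]; ring
    rw [this]
    refine hx2.trans ?_
    nlinarith

lemma cell_meas (γ : ℝ) (s : cIdx γ) : MeasurableSet (cellS γ s) := measurableSet_Ioc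

lemma cellK_lt (γ : ℝ) (l : ℕ) (hL : 0 < cL γ l) {k k' : ℕ} (h : k < k') {x : ℝ}
    (hx : x ∈ cellK γ l k) (hx' : x ∈ cellK γ l k') : False := by
  have hk : ((k : ℕ) : ℝ) + 1 ≤ k' := by exact_mod_cast h
  have := hx.2
  have := hx'.1
  nlinarith

lemma cell_eq (γ : ℝ) (h0 : 0 < γ) (h1 : γ ≤ 1) {s t : cIdx γ} {x : ℝ}
    (hs : x ∈ cellS γ s) (ht : x ∈ cellS γ t) : s = t := by
  have lev : ∀ s t : cIdx γ, x ∈ cellS γ s → x ∈ cellS γ t → ¬ s.1 < t.1 := by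
    intro s t hs ht h
    have a := (cell_sub γ h0 h1 s hs).1
    have b := (cell_sub γ h0 h1 t ht).2
    have : (1/2 : ℝ) ^ t.1 ≤ (1/2 : ℝ) ^ (s.1 + 1) :=
      pow_le_pow_of_le_one (by norm_num) (by norm_num) h
    linarith
  have hl : s.1 = t.1 := le_antisymm (not_lt.1 (lev t s ht hs)) (not_lt.1 (lev s t hs ht))
  obtain ⟨l, k⟩ := s
  obtain ⟨l', k'⟩ := t
  simp only at hl
  subst hl
  have hL : 0 < cL γ l := by
    obtain ⟨a, b, c, d⟩ := cN_bound γ h0 h1 l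
    exact lt_of_lt_of_le (by positivity) b
  congr 1
  rcases lt_trichotomy (k : ℕ) (k' : ℕ) with h | h | h
  · exact (cellK_lt γ l hL h hs ht).elim
  · exact Fin.ext h
  · exact (cellK_lt γ l hL h ht hs).elim

lemma cell_disj (γ : ℝ) (h0 : 0 < γ) (h1 : γ ≤ 1) :
    Pairwise (Function.onFun Disjoint (cellS γ)) := by
  intro s t hst
  refine Set.disjoint_left.2 fun x hs ht => hst (cell_eq γ h0 h1 hs ht)

lemma unif01_prob : IsProbabilityMeasure unif01 := by
  constructor; simp [unif01]

lemma unif01_Ioc (a b : ℝ) (ha : 0 ≤ a) (hab : a ≤ b) (hb : b ≤ 1) :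
    unif01.real (Ioc a b) = b - a := by
  unfold unif01
  rw [measureReal_def, Measure.restrict_apply measurableSet_Ioc, inter_eq_left.2, Real.volume_Ioc,
    ENNReal.toReal_ofReal (by linarith)]
  exact fun x hx => ⟨by linarith [hx.1], by linarith [hx.2]⟩

lemma cell_vol (γ : ℝ) (h0 : 0 < γ) (h1 : γ ≤ 1) (s : cIdx γ) :
    unif01.real (cellS γ s) = cL γ s.1 := by
  obtain ⟨a, b, c, d⟩ := cN_bound γ h0 h1 s.1
  have hL : 0 < cL γ s.1 := lt_of_lt_of_le (by positivity) b
  have hk : ((s.2 : ℕ) : ℝ) + 1 ≤ cN γ s.1 := by exact_mod_cast s.2.2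
  have hk0 : (0:ℝ) ≤ ((s.2 : ℕ) : ℝ) := by positivity
  unfold cellS cellK
  rw [unif01_Ioc]
  · ring
  · positivity
  · nlinarith
  · have e : (1/2 : ℝ) ^ s.1 = (1/2 : ℝ) ^ (s.1+1) + (1/2 : ℝ) ^ (s.1+1) := by rw [pow_succ]; ring
    have : (1/2 : ℝ) ^ s.1 ≤ 1 := pow_le_one₀ (by norm_num) (by norm_num)
    nlinarith

lemma oneI_sq_integral {S : Set ℝ} (hS : MeasurableSet S) (Q : Measure ℝ) :
    ∫ x, (oneI S x) ^ 2 ∂Q = Q.real S := by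
  simp_rw [sq, oneI_sq]
  exact oneI_integral hS Q

lemma vc_of (F : Set (ℝ → ℝ)) (h0 : ∀ f ∈ F, ∀ x, 0 ≤ f x)
    (h : ∀ f ∈ F, ∀ g ∈ F, ∀ x, 0 < f x → 0 < g x → f = g) : IsVCSubgraph F := by
  refine ⟨1, fun s hs => ?_⟩
  by_contra hc
  obtain ⟨p, hp, q, hq, hpq⟩ := Finset.one_lt_card.1 (not_le.1 hc)
  obtain ⟨_, ⟨f, hf, rfl⟩, h1⟩ := hs ∅ (by simp)
  obtain ⟨_, ⟨g, hg, rfl⟩, h2⟩ := hs {p} (by simpa using hp)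
  obtain ⟨_, ⟨k, hk, rfl⟩, h3⟩ := hs s (by simp)
  have a1 : ¬ p.2 < f p.1 := by simpa using h1 p hp
  have b1 : p.2 < g p.1 := by simpa using h2 p hp
  have b2 : ¬ q.2 < g q.1 := by
    have := h2 q hq
    simp only [mem_ofPred_eq, Finset.mem_singleton] at this
    exact fun hh => hpq (this.1 hh).symm
  have c1 : p.2 < k p.1 := by simpa [hp] using h3 p hp
  have c2 : q.2 < k q.1 := by simpa [hq] using h3 q hq
  have := h0 f hf p.1
  have e := h g hg k hk p.1 (by linarith) (by linarith)
  subst e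
  exact b2 c2

lemma lse_ex (F : Set (ℝ → ℝ)) (hne : F.Nonempty) (h : ∀ f ∈ F, ∀ x, f x = 0 ∨ f x = 1)
    (n : ℕ) (x : ℕ → ℝ) (y : ℕ → ℝ) : ∃ f, IsLSE F n x y f := by
  let obj : (Fin n → ℝ) → ℝ := fun v => ∑ i : Fin n, (y i - v i) ^ 2
  let ev : (ℝ → ℝ) → (Fin n → ℝ) := fun f i => f (x i)
  have fin : (ev '' F).Finite := by
    refine Set.Finite.subset (Set.Finite.pi' (fun _ : Fin n => (Set.toFinite ({0, 1} : Set ℝ)))) ?_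
    rintro _ ⟨f, hf, rfl⟩ i
    simpa [ev] using h f hf (x i)
  obtain ⟨v, ⟨f, hf, rfl⟩, hmin⟩ := Set.exists_min_image (ev '' F) obj fin (hne.image _)
  refine ⟨f, hf, fun g hg => ?_⟩
  have := hmin (ev g) ⟨g, hg, rfl⟩
  simp only [obj, ev] at this
  rw [Finset.sum_range, Finset.sum_range]
  exact this

lemma cF_val (γ : ℝ) : ∀ f ∈ cF γ, ∀ x, f x = 0 ∨ f x = 1 := by
  rintro f (rfl | ⟨s, rfl⟩) x
  · exact Or.inl rfl
  · by_cases hx : x ∈ cellS γ s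
    · exact Or.inr (oneI_mem hx)
    · exact Or.inl (oneI_not hx)

lemma cF_vc (γ : ℝ) (h0 : 0 < γ) (h1 : γ ≤ 1) : IsVCSubgraph (cF γ) := by
  refine vc_of _ (fun f hf x => ?_) ?_
  · rcases cF_val γ f hf x with h | h <;> rw [h] <;> norm_num
  · rintro f (rfl | ⟨s, rfl⟩) g (rfl | ⟨t, rfl⟩) x hf hg
    · rfl
    · simp at hf
    · simp at hg
    · have hs : x ∈ cellS γ s := by
        by_contra hh; simp only [oneI_not hh] at hf; exact lt_irrefl _ hf
      have ht : x ∈ cellS γ t := by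
        by_contra hh; simp only [oneI_not hh] at hg; exact lt_irrefl _ hg
      rw [cell_eq γ h0 h1 hs ht]

lemma cF_env (γ : ℝ) (h0 : 0 < γ) (h1 : γ ≤ 1) (δ : ℝ) (hδ : 0 < δ) :
    l2Norm unif01 (envl {g ∈ (fun f => f - (fun _ => (0:ℝ))) '' cF γ |
      (∫ x, g x ^ 2 ∂unif01) ≤ δ ^ 2}) ≤ 2 ^ γ * δ ^ γ := by
  have := unif01_prob
  set G := {g ∈ (fun f => f - (fun _ => (0:ℝ))) '' cF γ | (∫ x, g x ^ 2 ∂unif01) ≤ δ ^ 2} with hG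
  set b := ((2 * δ) ^ 2) ^ γ with hb
  have hb0 : 0 < b := by positivity
  have key : ∀ x, 0 ≤ envl G x ∧ envl G x ^ 2 ≤ oneI (Ioc 0 b) x := by
    intro x
    have hval : ∀ g ∈ G, |g x| ≤ oneI (Ioc 0 b) x := by
      rintro g ⟨⟨f, hf, rfl⟩, hg⟩
      rcases hf with rfl | ⟨s, rfl⟩
      · simpa using oneI_nonneg _ x
      · have e : (fun f => f - (fun _ => (0:ℝ))) ((fun s : cIdx γ => oneI (cellS γ s)) s) =
          oneI (cellS γ s) := by funext y; simp
        rw [e] at hg ⊢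
        rw [oneI_sq_integral (cell_meas γ s), cell_vol γ h0 h1] at hg
        by_cases hx : x ∈ cellS γ s
        · have hx' := cell_sub γ h0 h1 s hx
          have hxb : x ∈ Ioc 0 b := by
            refine ⟨lt_trans (by positivity) hx'.1, hx'.2.trans ?_⟩
            have hh := (cN_bound γ h0 h1 s.1).2.1
            have h4 : ((1/2 : ℝ) ^ s.1) ^ (1/γ) ≤ (2 * δ) ^ 2 := by nlinarith
            calc (1/2 : ℝ) ^ s.1 = (((1/2 : ℝ) ^ s.1) ^ (1/γ)) ^ γ := by
                  rw [← Real.rpow_mul (by positivity)]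
                  rw [one_div_mul_cancel h0.ne', Real.rpow_one]
              _ ≤ b := Real.rpow_le_rpow (by positivity) h4 h0.le
          rw [oneI_mem hx, oneI_mem hxb]; simp
        · rw [oneI_not hx]; simpa using oneI_nonneg _ x
    have n0 : 0 ≤ envl G x := Real.sSup_nonneg (by rintro _ ⟨g, _, rfl⟩; exact abs_nonneg _)
    have n1 : envl G x ≤ oneI (Ioc 0 b) x :=
      Real.sSup_le (by rintro _ ⟨g, hg, rfl⟩; exact hval g hg) (oneI_nonneg _ _)
    refine ⟨n0, ?_⟩
    calc envl G x ^ 2 ≤ oneI (Ioc 0 b) x ^ 2 := pow_le_pow_left₀ n0 n1 2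
      _ = _ := by rw [sq, oneI_sq]
  have hle : ∫ x, envl G x ^ 2 ∂unif01 ≤ b := by
    refine (integral_mono_of_nonneg (Filter.Eventually.of_forall fun x => sq_nonneg _)
      (oneI_int measurableSet_Ioc unif01)
      (Filter.Eventually.of_forall fun x => (key x).2)).trans ?_
    rw [oneI_integral measurableSet_Ioc]
    unfold unif01
    rw [measureReal_def, Measure.restrict_apply measurableSet_Ioc]
    refine (ENNReal.toReal_mono (by simp) (measure_mono inter_subset_left)).trans ?_
    rw [Real.volume_Ioc, ENNReal.toReal_ofReal (by linarith)]; linarith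
  unfold l2Norm
  refine (Real.sqrt_le_sqrt hle).trans (le_of_eq ?_)
  rw [← Real.mul_rpow (by norm_num) hδ.le, hb]
  rw [← Real.rpow_natCast, ← Real.rpow_mul (by positivity), mul_comm ((2:ℕ):ℝ) γ, Real.rpow_mul (by positivity),
    Real.rpow_natCast, Real.sqrt_sq (by positivity)]

lemma obj_eq (n : ℕ) (S : Set ℝ) (x z : ℕ → ℝ) :
    ∑ i ∈ Finset.range n, (0 + z i - oneI S (x i)) ^ 2 =
      ∑ i ∈ Finset.range n, z i ^ 2 - ∑ i ∈ Finset.range n, oneI S (x i) * (2 * z i - 1) := by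
  rw [← Finset.sum_sub_distrib]
  refine Finset.sum_congr rfl fun i _ => ?_
  have := oneI_sq S (x i)
  nlinarith

lemma lse_good (γ : ℝ) (h0 : 0 < γ) (h1 : γ ≤ 1) (n l0 l1 : ℕ) (x z : ℕ → ℝ) (A : ℝ) (hA : 1 ≤ A)
    (hbig : ∃ k : Fin (cN γ l1), 4 * A ≤
      ∑ j ∈ Finset.range n, oneI (cellS γ ⟨l1, k⟩) (x j) * (2 * z j - 1))
    (hdeep : ∀ s : {s : cIdx γ // l0 ≤ s.1},
      ∑ j ∈ Finset.range n, oneI (cellS γ s.1) (x j) * z j < A)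
    (f : ℝ → ℝ) (hf : IsLSE (cF γ) n x (fun i => (fun _ => (0:ℝ)) (x i) + z i) f) :
    Real.sqrt (((1/2 : ℝ) ^ l0) ^ (1/γ) / 4) ≤ l2Dist unif01 f (fun _ => 0) := by
  obtain ⟨k, hk⟩ := hbig
  obtain ⟨hfF, hmin⟩ := hf
  have h2 := hmin (oneI (cellS γ ⟨l1, k⟩)) (Or.inr ⟨_, rfl⟩)
  simp only at h2
  rw [obj_eq] at h2
  rcases hfF with rfl | ⟨s, rfl⟩
  · simp only [zero_add, sub_zero] at h2
    linarith
  · simp only at h2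
    rw [obj_eq] at h2
    have hs : s.1 < l0 := by
      by_contra hh
      have h3 := hdeep ⟨s, not_lt.1 hh⟩
      simp only at h3
      have : ∑ i ∈ Finset.range n, oneI (cellS γ s) (x i) * (2 * z i - 1) ≤
          2 * ∑ i ∈ Finset.range n, oneI (cellS γ s) (x i) * z i := by
        rw [Finset.mul_sum]
        refine Finset.sum_le_sum fun i _ => ?_
        nlinarith [oneI_nonneg (cellS γ s) (x i)]
      linarith
    unfold l2Dist
    simp only [sub_zero]
    rw [oneI_sq_integral (cell_meas γ s), cell_vol γ h0 h1]
    refine Real.sqrt_le_sqrt (le_trans ?_ (cN_bound γ h0 h1 s.1).2.1)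
    gcongr ?_ / 4
    refine Real.rpow_le_rpow (by positivity) ?_ (by positivity)
    exact pow_le_pow_of_le_one (by norm_num) (by norm_num) hs.le

set_option maxHeartbeats 2000000 in
lemma numeric (γ b κ C Dc : ℝ) (hγ0 : 0 < γ) (hγ1 : γ ≤ 1) (hb1 : 1 < b) (hb2 : b < 2)
    (hC : 1 ≤ C) (hκ : κ = 1 / (2 * C)) (hD : 0 ≤ Dc) (m : ℕ) (hm : 144 * (1 + Dc) ≤ 2 ^ m)
    (n : ℕ) (hn : 1 ≤ n) :
    ∃ (l1 : ℕ) (A : ℝ), 1 ≤ A ∧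
      (∀ θ, θ = n * (cN γ l1 * cL γ l1 * ((3 * A) ^ (-b) / 2)) →
        κ / 288 ≤ θ - θ ^ 2 - θ * (n * cL γ l1 * C / A) -
          n * (1/2 : ℝ) ^ (l1 + m) * (A ^ (-b) + (Dc * A ^ (2 - b)) / A ^ 2)) ∧
      Real.sqrt (((1/2 : ℝ) ^ m * (κ / 2)) ^ (1/γ) / 4) * (n:ℝ) ^ (-(1 / (2 * (2 - γ)))) ≤
        Real.sqrt (((1/2 : ℝ) ^ (l1 + m)) ^ (1/γ) / 4) := by
  have hn1 : (1:ℝ) ≤ n := by exact_mod_cast hn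
  have hn0 : (0:ℝ) < n := by linarith
  have hκ0 : 0 < κ := by rw [hκ]; positivity
  have hκ1 : κ ≤ 1 / 2 := by
    rw [hκ, div_le_div_iff₀ (by positivity) (by norm_num)]; linarith
  have hκC : κ * C = 1 / 2 := by rw [hκ]; field_simp
  have h2γ : 0 < 2 - γ := by linarith
  set a := 1 / (2 - γ) with ha
  have haγ : a * (2 - γ) = 1 := by rw [ha]; field_simp
  have ha0 : 0 < a := by positivity
  have ha1 : a ≤ 1 := by nlinarith
  set u := (n:ℝ) ^ (γ * a) with hu
  have hu0 : 0 < u := by positivity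
  have hu1 : 1 ≤ u := Real.one_le_rpow hn1 (by positivity)
  obtain ⟨k, hk1, hk2⟩ := exists_nat_pow_near_of_lt_one (x := κ / u) (y := (1/2:ℝ)) (by positivity)
    ((div_le_one hu0).2 (by linarith)) (by norm_num) (by norm_num)
  set h := (1/2 : ℝ) ^ (k+1) with hh
  have hh0 : 0 < h := by positivity
  have hu_le : h * u ≤ κ := by
    have := (lt_div_iff₀ hu0).1 hk1; linarith
  have hu_ge : κ / 2 ≤ h * u := by
    have e : (1/2 : ℝ) ^ k = 2 * h := by rw [hh, pow_succ]; ring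
    rw [e] at hk2
    have := (div_le_iff₀ hu0).1 hk2
    linarith
  set A := (n:ℝ) ^ (2 * (1 - a) / b) with hA
  have hA1 : 1 ≤ A := Real.one_le_rpow hn1 (div_nonneg (by linarith) (by linarith))
  have hA0 : 0 < A := by linarith
  have hAb : n * A ^ (-b) = u := by
    rw [hA, ← Real.rpow_mul hn0.le, hu]
    conv_lhs => rw [← Real.rpow_one (n:ℝ)]
    rw [Real.rpow_one, ← Real.rpow_one_add' hn0.le]
    · congr 1
      have : 2 * (1 - a) / b * -b = -(2 * (1 - a)) := by field_simp
      rw [this]; linarith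
    · have : 2 * (1 - a) / b * -b = -(2 * (1 - a)) := by field_simp
      rw [this]; nlinarith
  have h3 : (1:ℝ)/9 ≤ (3:ℝ) ^ (-b) ∧ (3:ℝ) ^ (-b) ≤ 1 := by
    constructor
    · have : (1:ℝ)/9 = (3:ℝ) ^ (-2 : ℝ) := by
        rw [Real.rpow_neg (by norm_num), Real.rpow_ofNat]; norm_num
      rw [this]
      exact Real.rpow_le_rpow_of_exponent_le (by norm_num) (by linarith)
    · exact Real.rpow_le_one_of_one_le_of_nonpos (by norm_num) (by linarith)
  obtain ⟨c1, c2, c3, c4⟩ := cN_bound γ hγ0 hγ1 (k+1)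
  rw [← hh] at c2 c3
  refine ⟨k + 1, A, hA1, ?_, ?_⟩
  · intro θ hθ
    have hθ' : θ = (h * u) * (3:ℝ) ^ (-b) / 4 := by
      rw [hθ, c4, pow_succ, ← hh, Real.mul_rpow (by norm_num) hA0.le, ← hAb]; ring
    have hLA : n * cL γ (k+1) ≤ κ / 2 * A := by
      have e1 : h ^ (1/γ) ≤ κ * (n:ℝ) ^ (-a) := by
        have : h ≤ κ / u := hk1.le
        calc h ^ (1/γ) ≤ (κ / u) ^ (1/γ) := Real.rpow_le_rpow hh0.le this (by positivity)
          _ = κ ^ (1/γ) * (n:ℝ) ^ (-a) := by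
            rw [Real.div_rpow hκ0.le hu0.le, hu, ← Real.rpow_mul hn0.le, Real.rpow_neg hn0.le,
              div_eq_mul_inv]
            congr 3; field_simp
          _ ≤ κ * (n:ℝ) ^ (-a) := by
            gcongr
            conv_rhs => rw [← Real.rpow_one κ]
            exact Real.rpow_le_rpow_of_exponent_ge hκ0 (by linarith) ((one_le_div hγ0).2 hγ1)
      have e2 : n * (n:ℝ) ^ (-a) ≤ A := by
        calc n * (n:ℝ) ^ (-a) = (n:ℝ) ^ (1 - a) := by
              rw [sub_eq_add_neg, Real.rpow_add hn0, Real.rpow_one]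
          _ ≤ A := by
              refine Real.rpow_le_rpow_of_exponent_le hn1 ?_
              rw [le_div_iff₀ (by linarith)]
              nlinarith
      calc n * cL γ (k+1) ≤ n * (h ^ (1/γ) / 2) := by gcongr
        _ ≤ n * (κ * (n:ℝ) ^ (-a) / 2) := by gcongr
        _ = κ / 2 * (n * (n:ℝ) ^ (-a)) := by ring
        _ ≤ _ := by gcongr
    have hθ0 : 0 ≤ θ := by rw [hθ']; positivity
    have tC : θ * (n * cL γ (k+1) * C / A) ≤ θ / 4 := by
      have : n * cL γ (k+1) * C / A ≤ 1 / 4 := by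
        rw [div_le_iff₀ hA0]
        calc n * cL γ (k+1) * C ≤ κ / 2 * A * C := by gcongr
          _ = (κ * C) / 2 * A := by ring
          _ = 1 / 4 * A := by rw [hκC]; ring
      have f3 := mul_le_mul_of_nonneg_left this hθ0
      linarith
    have tD : n * (1/2 : ℝ) ^ (k + 1 + m) * (A ^ (-b) + (Dc * A ^ (2 - b)) / A ^ 2) ≤ θ / 4 := by
      have e : A ^ (2 - b) / A ^ 2 = A ^ (-b) := by
        rw [sub_eq_add_neg, Real.rpow_add hA0, Real.rpow_ofNat]; field_simp
      have e' : n * (1/2 : ℝ) ^ (k + 1 + m) * (A ^ (-b) + (Dc * A ^ (2 - b)) / A ^ 2) =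
          (h * u) * ((1 + Dc) / 2 ^ m) := by
        rw [mul_div_assoc, e, pow_add, ← hh, ← hAb]; rw [one_div, inv_pow]; ring
      have e3 : (1 + Dc) / 2 ^ m ≤ 1 / 144 := by
        rw [div_le_div_iff₀ (by positivity) (by norm_num)]; linarith
      rw [e', hθ']
      have hpos : 0 ≤ h * u := by positivity
      have f1 := mul_le_mul_of_nonneg_left e3 hpos
      have f2 := mul_le_mul_of_nonneg_left h3.1 hpos
      linarith
    have tS : θ ^ 2 ≤ θ / 4 := by
      have : θ ≤ 1 / 4 := by
        rw [hθ']
        have hpos : 0 ≤ h * u := by positivity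
        have f2 := mul_le_mul_of_nonneg_left h3.2 hpos
        linarith
      have f3 := mul_le_mul_of_nonneg_left this hθ0
      rw [sq]; linarith
    have tθ : κ / 72 ≤ θ := by
      rw [hθ']
      have hpos : 0 ≤ h * u := by positivity
      have f2 := mul_le_mul_of_nonneg_left h3.1 hpos
      linarith
    linarith
  · have e : (n:ℝ) ^ (-(1 / (2 * (2 - γ)))) = Real.sqrt ((n:ℝ) ^ (-a)) := by
      rw [Real.sqrt_eq_rpow, ← Real.rpow_mul hn0.le]
      congr 1; rw [ha]; field_simp
    rw [e, ← Real.sqrt_mul (by positivity)]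
    refine Real.sqrt_le_sqrt ?_
    rw [div_mul_eq_mul_div]
    gcongr ?_ / 4
    have : (n:ℝ) ^ (-a) = (u⁻¹) ^ (1/γ) := by
      rw [hu, ← Real.rpow_neg hn0.le, ← Real.rpow_mul hn0.le]
      congr 1; field_simp
    rw [this, ← Real.mul_rpow (by positivity) (by positivity)]
    refine Real.rpow_le_rpow (by positivity) ?_ (by positivity)
    rw [pow_add, ← hh, ← div_eq_mul_inv, div_le_iff₀ hu0]
    have hpos : 0 ≤ (1/2:ℝ) ^ m := by positivity
    have f1 := mul_le_mul_of_nonneg_left hu_ge hpos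
    linarith

/-- Theorem 2.4 / `thm:envelope_rate_lower_bound`.
Lower bound: for each `γ ∈ (0,1]` there is a uniformly bounded VC-subgraph class
satisfying the envelope growth condition, on which for suitable heavy-tailed errors the LSE
converges no faster than `n^{-1/(2(2-γ)) - (2/γ)ε}` with positive probability. -/
theorem statement2 (γ : ℝ) (hγ0 : 0 < γ) (hγ1 : γ ≤ 1) :
    ∃ (Ftil : Set (ℝ → ℝ)) (B : ℝ),
      (∀ f ∈ Ftil, ∀ x, |f x| ≤ B) ∧ IsVCSubgraph Ftil ∧
      ∃ f0 ∈ Ftil,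
        (∃ c : ℝ, 0 < c ∧ ∀ δ : ℝ, 0 < δ →
          l2Norm unif01
              (envl {g ∈ (fun f => f - f0) '' Ftil | (∫ x, g x ^ 2 ∂unif01) ≤ δ ^ 2}) ≤
            c * δ ^ γ) ∧
        ∀ ε : ℝ, 0 < ε → ε < 1 / 2 →
          ∃ ceg : ℝ, 0 < ceg ∧ ∃ pr : ℝ, 0 < pr ∧
          ∃ ν : Measure ℝ, IsProbabilityMeasure ν ∧
            Integrable (fun x : ℝ => x) ν ∧ (∫ x, x ∂ν) = 0 ∧
            Integrable (fun x : ℝ => |x| ^ (2 * (1 - ε))) ν ∧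
            ∃ N : ℕ, ∀ n : ℕ, N ≤ n →
              ∀ (Ω : Type) (_ : MeasurableSpace Ω) (μ : Measure Ω),
                IsProbabilityMeasure μ →
              ∀ (X : ℕ → Ω → ℝ) (ξ : ℕ → Ω → ℝ),
                (∀ i, Measurable (X i)) → (∀ i, Measurable (ξ i)) →
                iIndepFun X μ →
                (∀ i, Measure.map (X i) μ = unif01) →
                iIndepFun ξ μ →
                (∀ i, Measure.map (ξ i) μ = ν) →
                IndepFun (fun ω i => X i ω) (fun ω i => ξ i ω) μ →
                ∃ fstar : Ω → ℝ → ℝ,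
                  (∀ ω, IsLSE Ftil n (fun i => X i ω) (fun i => f0 (X i ω) + ξ i ω) (fstar ω)) ∧
                  ENNReal.ofReal pr ≤
                    μ {ω | ceg * (n : ℝ) ^ (-(1 / (2 * (2 - γ))) - (2 / γ) * ε) ≤
                        l2Dist unif01 (fstar ω) f0} := by
  refine ⟨cF γ, 1, ?_, cF_vc γ hγ0 hγ1, fun _ => 0, Or.inl rfl, ⟨2 ^ γ, by positivity,
    fun δ hδ => cF_env γ hγ0 hγ1 δ hδ⟩, ?_⟩
  · intro f hf x
    rcases cF_val γ f hf x with h | h <;> simp [h]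
  intro ε hε0 hε1
  obtain ⟨q1, q2, q3, q4, q5, q6, q7, q8⟩ := parS_all (2 - ε) (by linarith) (by linarith)
  set b := 2 - ε with hb
  set C := ∫ x, (2 * |x| + 1) ∂(parS b) with hCdef
  have hC : 1 ≤ C := by
    have hi : Integrable (fun x : ℝ => 2 * |x| + 1) (parS b) :=
      (q2.abs.const_mul 2).add (integrable_const 1)
    have := integral_mono (integrable_const (1:ℝ)) hi
      (fun x => by simp only; linarith [abs_nonneg x])
    simpa using this
  set Dc := b / (2 - b) with hDc
  have hD : 0 ≤ Dc := div_nonneg (by linarith) (by linarith)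
  obtain ⟨m, hm⟩ := pow_unbounded_of_one_lt (144 * (1 + Dc)) (one_lt_two (α := ℝ))
  set κ := 1 / (2 * C) with hκ
  have hκ0 : 0 < κ := by positivity
  refine ⟨Real.sqrt (((1/2 : ℝ) ^ m * (κ / 2)) ^ (1/γ) / 4), by positivity, κ / 288, by positivity,
    parS b, q1, q2, q3, q4 _ (by linarith), 1, ?_⟩
  intro n hn Ω _ μ hμ X ξ hX hξ hXI hXP hξI hξν hI
  have hU := unif01_prob
  have H : RegS μ unif01 (parS b) X ξ := ⟨hX, hξ, hXP, hξν, hXI, hξI, hI⟩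
  obtain ⟨l1, A, hA1, hθ, hrate⟩ := numeric γ b κ C Dc hγ0 hγ1 (by linarith) (by linarith) hC hκ hD
    m hm.le n hn
  choose fstar hf using fun ω => lse_ex (cF γ) ⟨_, Or.inl rfl⟩ (cF_val γ) n (fun i => X i ω)
    (fun i => (fun _ => (0:ℝ)) (X i ω) + ξ i ω)
  refine ⟨fstar, hf, ?_⟩
  have hd1 : (1/2 : ℝ) ^ (l1 + m) ≤ 1 := pow_le_one₀ (by norm_num) (by norm_num)
  have hPD : unif01.real (Ioc 0 ((1/2 : ℝ) ^ (l1 + m))) = (1/2 : ℝ) ^ (l1 + m) := by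
    rw [unif01_Ioc _ _ le_rfl (by positivity) hd1, sub_zero]
  have main := core_main H n (cN γ l1)
    (J := fun s : {s : cIdx γ // l1 + m ≤ s.1} => cellS γ s.1)
    (fun s => cell_meas γ s.1)
    (fun s t hst => cell_disj γ hγ0 hγ1 (fun e => hst (Subtype.ext e)))
    (D := Ioc 0 ((1/2 : ℝ) ^ (l1 + m))) measurableSet_Ioc
    (fun s x hx => by
      have hx' := cell_sub γ hγ0 hγ1 s.1 hx
      exact ⟨lt_trans (by positivity) hx'.1,
        hx'.2.trans (pow_le_pow_of_le_one (by norm_num) (by norm_num) s.2)⟩)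
    (I := fun k => cellS γ ⟨l1, k⟩) (fun k => cell_meas γ _)
    (fun k k' hk => cell_disj γ hγ0 hγ1 (fun e => hk (by simpa using e)))
    (L := cL γ l1) (fun k => cell_vol γ hγ0 hγ1 ⟨l1, k⟩) hA1 q2 (q5 A) rfl
  rw [hPD, q7 (3 * A) (by linarith), ← hCdef] at main
  have num := hθ _ rfl
  have hlast : n * (1/2 : ℝ) ^ (l1 + m) * ((parS b).real {x | A < |x|} +
        (∫ x, (if |x| ≤ A then x else 0) ^ 2 ∂(parS b)) / A ^ 2) ≤
      n * (1/2 : ℝ) ^ (l1 + m) * (A ^ (-b) + (Dc * A ^ (2 - b)) / A ^ 2) := by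
    have w1 := q8 A hA1
    have w2 := q6 A hA1
    gcongr
  have fin : κ / 288 ≤ μ.real {ω | (∃ k, 4 * A ≤ ∑ j ∈ Finset.range n,
      oneI (cellS γ ⟨l1, k⟩) (X j ω) * (2 * ξ j ω - 1)) ∧
      ∀ k : {s : cIdx γ // l1 + m ≤ s.1},
        ∑ j ∈ Finset.range n, oneI (cellS γ k.1) (X j ω) * ξ j ω < A} := by linarith
  refine (ENNReal.ofReal_le_ofReal fin).trans ?_
  rw [ofReal_measureReal]
  refine measure_mono ?_
  rintro ω ⟨h1, h2⟩
  have hl := lse_good γ hγ0 hγ1 n (l1 + m) l1 (fun i => X i ω) (fun i => ξ i ω) A hA1 h1 h2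
    (fstar ω) (hf ω)
  refine le_trans ?_ (hrate.trans hl)
  refine mul_le_mul_of_nonneg_left ?_ (Real.sqrt_nonneg _)
  refine Real.rpow_le_rpow_of_exponent_le (by exact_mod_cast hn) ?_
  have : 0 < 2 / γ * ε := by positivity
  linarith
end
end

section
/- Let $\gamma\in(0,1]$ and let $\tilde{\mathcal{F}}$ be the tree-structured class of indicator functions on $[0,1]$ (described in the context). Let $P$ be the uniform distribution on $[0,1]$ and for $\delta>0$ let $\tilde F(\delta)(x)=\sup\{f(x): f\in\tilde{\mathcal{F}},\ Pf^2\le\delta^2\}$ be the envelope of the localized class. Then $\|\tilde F(\delta)\|_{L_2(P)}\le \sqrt{2}\,\delta^{\gamma}$ for all $\delta>0$. -/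
open MeasureTheory ProbabilityTheory Set
open scoped ENNReal

noncomputable section

theorem aux_norm (G : Set (ℝ → ℝ)) (S : Set ℝ) (hS : MeasurableSet S) (c : ℝ) (hc : 0 ≤ c)
    (hG : ∀ f ∈ G, ∀ x, |f x| ≤ S.indicator (fun _ => (1 : ℝ)) x)
    (hm : volume S ≤ ENNReal.ofReal (c ^ 2)) :
    l2Norm unif01 (envl G) ≤ Real.sqrt 2 * c := by
  have hi : ∀ x, 0 ≤ S.indicator (fun _ => (1 : ℝ)) x := fun x =>
    Set.indicator_nonneg (fun _ _ => zero_le_one) x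
  have h0 : ∀ x, 0 ≤ envl G x := by
    intro x
    apply Real.sSup_nonneg
    rintro _ ⟨f, _, rfl⟩
    exact abs_nonneg _
  have h1 : ∀ x, envl G x ≤ S.indicator (fun _ => (1 : ℝ)) x := by
    intro x
    apply Real.sSup_le _ (hi x)
    rintro _ ⟨f, hf, rfl⟩
    exact hG f hf x
  have hfin : volume S < ⊤ := lt_of_le_of_lt hm ENNReal.ofReal_lt_top
  have hu : unif01 S ≤ volume S := Measure.restrict_apply_le _ _
  have h2 : ∫ x, envl G x ^ 2 ∂unif01 ≤ c ^ 2 := by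
    calc ∫ x, envl G x ^ 2 ∂unif01 ≤ ∫ x, S.indicator (fun _ => (1 : ℝ)) x ∂unif01 := by
          apply integral_mono_of_nonneg
          · exact Filter.Eventually.of_forall fun x => sq_nonneg _
          · rw [integrable_indicator_iff hS]
            exact integrableOn_const (lt_of_le_of_lt hu hfin).ne
          · refine Filter.Eventually.of_forall fun x => ?_
            have a := h0 x
            have b := h1 x
            by_cases hx : x ∈ S
            · simp only [hx, Set.indicator_of_mem] at b ⊢
              nlinarith
            · simp only [hx, not_false_eq_true, Set.indicator_of_notMem] at b ⊢
              nlinarith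
      _ = unif01.real S := by
          exact integral_indicator_one (μ := unif01) hS
      _ ≤ c ^ 2 := by
          exact ENNReal.toReal_le_of_le_ofReal (sq_nonneg c) (hu.trans hm)
  have h3 : l2Norm unif01 (envl G) ≤ c := by
    unfold l2Norm
    exact (Real.sqrt_le_sqrt h2).trans (Real.sqrt_sq hc).le
  have h4 : (1 : ℝ) ≤ Real.sqrt 2 := Real.one_le_sqrt.mpr (by norm_num)
  nlinarith

theorem aux_int (a b : ℝ) (ha : 0 ≤ a) (hb : b ≤ 1) (hab : a ≤ b) :
    ∫ x, (Set.indicator (Set.Icc a b) (fun _ => (1 : ℝ)) x) ^ 2 ∂unif01 = b - a := by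
  have e : ∀ x, (Set.indicator (Set.Icc a b) (fun _ => (1 : ℝ)) x) ^ 2
      = Set.indicator (Set.Icc a b) 1 x := by
    intro x
    by_cases hx : x ∈ Set.Icc a b
    · simp [Set.indicator_of_mem hx]
    · simp [Set.indicator_of_notMem hx]
  simp_rw [e]
  rw [integral_indicator_one measurableSet_Icc, unif01, measureReal_restrict_apply measurableSet_Icc,
    Set.inter_eq_left.mpr (Set.Icc_subset_Icc ha hb)]
  simp [hab]

/-- Lemma 5.4 / `lem:tilde_F_cond`.
The localized envelopes of the tree-structured class satisfy
`‖F̃(δ)‖_{L₂(P)} ≤ √2 δ^γ`. -/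
theorem statement8 (γ : ℝ) (hγ0 : 0 < γ) (hγ1 : γ ≤ 1)
    (Ftil : Set (ℝ → ℝ)) (hTree : TreeModel γ Ftil) :
    ∀ δ : ℝ, 0 < δ →
      l2Norm unif01 (envl {f ∈ Ftil | (∫ x, f x ^ 2 ∂unif01) ≤ δ ^ 2}) ≤
        Real.sqrt 2 * δ ^ γ := by
  intro δ hδ
  rcases hTree with ⟨hlt, C, ⟨hcard, hint, hnest⟩, rfl⟩ | ⟨rfl, rfl⟩
  · obtain ⟨q, hq⟩ : ∃ q : ℝ, q = ((2 : ℝ) ^ ((1 : ℝ) / (1 - γ)))⁻¹ := ⟨_, rfl⟩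
    rw [← hq] at hint
    have h1γ : 0 < 1 - γ := by linarith
    have hq0 : 0 < q := by rw [hq]; positivity
    have hq1 : q < 1 := by
      rw [hq]
      exact inv_lt_one_of_one_lt₀ (Real.one_lt_rpow (by norm_num) (by positivity))
    have h2q : 2 * q = q ^ γ := by
      have : q ^ (1 - γ) = 1 / 2 := by
        rw [hq, Real.inv_rpow (by positivity), ← Real.rpow_mul (by norm_num),
          one_div_mul_cancel h1γ.ne']
        norm_num
      have h3 : q ^ γ * q ^ (1 - γ) = q := by
        rw [← Real.rpow_add hq0]; simp
      rw [this] at h3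
      linarith
    have hex : ∃ l, 1 ≤ l ∧ q ^ l ≤ δ ^ 2 := by
      obtain ⟨n, hn⟩ := exists_pow_lt_of_lt_one (sq_pos_of_pos hδ) hq1
      refine ⟨n + 1, by omega, le_trans ?_ hn.le⟩
      exact pow_le_pow_of_le_one hq0.le hq1.le (by omega)
    classical
    obtain ⟨hl1, hlq⟩ := Nat.find_spec hex
    have hmin : ∀ l, 1 ≤ l → q ^ l ≤ δ ^ 2 → Nat.find hex ≤ l :=
      fun l a b => Nat.find_min' hex ⟨a, b⟩
    generalize Nat.find hex = L at hl1 hlq hmin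
    have hnest' : ∀ l, L ≤ l → ∀ I ∈ C l, ∃ J ∈ C L, I ⊆ J := by
      intro l hl
      induction l, hl using Nat.le_induction with
      | base => exact fun I hI => ⟨I, hI, subset_rfl⟩
      | succ l hl ih =>
        intro I hI
        obtain ⟨J, hJ, hIJ⟩ := hnest l (hl1.trans hl) I hI
        obtain ⟨K, hK, hJK⟩ := ih J hJ
        exact ⟨K, hK, hIJ.trans hJK⟩
    apply aux_norm _ (⋃ J ∈ C L, J)
    · apply Finset.measurableSet_biUnion
      intro J hJ
      obtain ⟨a, _, _, rfl⟩ := hint L hl1 J hJ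
      exact measurableSet_Icc
    · positivity
    · rintro f ⟨hf, hfi⟩ x
      rcases hf with rfl | ⟨l, hl, I, hI, rfl⟩
      · simpa using Set.indicator_nonneg (fun _ _ => zero_le_one) x
      · obtain ⟨a, ha, hb, rfl⟩ := hint l hl I hI
        have hp : 0 < q ^ l := by positivity
        rw [aux_int _ _ ha hb (by linarith)] at hfi
        obtain ⟨J, hJ, hIJ⟩ := hnest' l (hmin l hl (by linarith)) _ hI
        rw [abs_of_nonneg (Set.indicator_nonneg (fun _ _ => zero_le_one) x)]
        apply Set.indicator_le_indicator_of_subset _ (fun _ => zero_le_one)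
        exact hIJ.trans (Set.subset_biUnion_of_mem (u := fun J : Set ℝ => J) hJ)
    · calc volume (⋃ J ∈ C L, J) ≤ ∑ J ∈ C L, volume J := measure_biUnion_finset_le _ _
        _ = ∑ J ∈ C L, ENNReal.ofReal (q ^ L) := by
            apply Finset.sum_congr rfl
            intro J hJ
            obtain ⟨a, _, _, rfl⟩ := hint L hl1 J hJ
            simp
        _ = ENNReal.ofReal ((2 * q) ^ L) := by
            rw [Finset.sum_const, hcard L hl1, mul_pow, ENNReal.ofReal_mul (by positivity),
              nsmul_eq_mul, ENNReal.ofReal_pow (by norm_num : (0:ℝ) ≤ 2)]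
            simp
        _ ≤ ENNReal.ofReal ((δ ^ γ) ^ 2) := by
            apply ENNReal.ofReal_le_ofReal
            rw [h2q, Real.rpow_pow_comm hq0.le, Real.rpow_pow_comm hδ.le]
            exact Real.rpow_le_rpow (by positivity) hlq hγ0.le
  · rw [Real.rpow_one]
    apply aux_norm _ (Set.Icc 0 (δ ^ 2)) measurableSet_Icc _ hδ.le
    · rintro f ⟨⟨d, ⟨hd0, hd1⟩, rfl⟩, hfi⟩ x
      rw [aux_int _ _ le_rfl hd1 hd0] at hfi
      rw [abs_of_nonneg (Set.indicator_nonneg (fun _ _ => zero_le_one) x)]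
      exact Set.indicator_le_indicator_of_subset
        (Set.Icc_subset_Icc le_rfl (by linarith)) (fun _ => zero_le_one) x
    · simp
end
end

section
/- If $f$ is a convex function on $[0,1]$ with $\int_0^1 |f(x)|^2\,dx\le 1$, then $|f(x)|\le 2\sqrt{3}\,\big(x^{-1/2}\vee(1-x)^{-1/2}\big)$ for all $x\in(0,1)$. -/
open MeasureTheory ProbabilityTheory Set
open scoped ENNReal

noncomputable section

lemma cvx3 {f : ℝ → ℝ} (hf : ConvexOn ℝ (Set.Icc 0 1) f) {a b c : ℝ} (ha : 0 ≤ a) (hab : a ≤ b)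
    (hbc : b ≤ c) (hc : c ≤ 1) : (c - a) * f b ≤ (c - b) * f a + (b - a) * f c := by
  rcases eq_or_lt_of_le (hab.trans hbc) with h | h
  · have h1 : a = b := by linarith
    have h2 : b = c := by linarith
    subst h1; subst h2; simp
  · have hp : 0 < c - a := by linarith
    have := hf.2 (⟨ha, by linarith⟩ : a ∈ Set.Icc (0:ℝ) 1)
      (⟨by linarith, hc⟩ : c ∈ Set.Icc (0:ℝ) 1)
      (div_nonneg (by linarith) hp.le : 0 ≤ (c - b) / (c - a))
      (div_nonneg (by linarith) hp.le : 0 ≤ (b - a) / (c - a)) (by field_simp; ring)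
    simp only [smul_eq_mul] at this
    have e : (c - b) / (c - a) * a + (b - a) / (c - a) * c = b := by field_simp; ring
    rw [e] at this
    have h3 := mul_le_mul_of_nonneg_left this hp.le
    have e2 : (c - a) * ((c - b) / (c - a) * f a + (b - a) / (c - a) * f c)
      = (c - b) * f a + (b - a) * f c := by field_simp
    linarith

lemma cvx_int {f : ℝ → ℝ} (hf : ConvexOn ℝ (Set.Icc 0 1) f) :
    IntegrableOn (fun x => |f x| ^ 2) (Set.Icc (0 : ℝ) 1) volume := by
  have hcont : ContinuousOn f (Set.Ioo 0 1) :=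
    (hf.subset Ioo_subset_Icc_self (convex_Ioo 0 1)).continuousOn isOpen_Ioo
  rw [integrableOn_Icc_iff_integrableOn_Ioo]
  have hub : ∀ y ∈ Set.Icc (0:ℝ) 1, f y ≤ |f 0| + |f 1| := by
    intro y hy
    have := cvx3 hf le_rfl hy.1 hy.2 le_rfl
    have h1 := le_abs_self (f 0)
    have h2 := le_abs_self (f 1)
    have h3 := abs_nonneg (f 0)
    have h4 := abs_nonneg (f 1)
    nlinarith [hy.1, hy.2, mul_nonneg hy.1 h3, mul_nonneg (sub_nonneg.2 hy.2) h4,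
      mul_nonneg hy.1 (sub_nonneg.2 h2), mul_nonneg (sub_nonneg.2 hy.2) (sub_nonneg.2 h1)]
  have hlb : ∀ y ∈ Set.Icc (0:ℝ) 1, 2 * f (1/2) - (|f 0| + |f 1|) ≤ f y := by
    intro y hy
    have h1 := hub (1 - y) ⟨by linarith [hy.2], by linarith [hy.1]⟩
    have := hf.2 hy (⟨by linarith [hy.2], by linarith [hy.1]⟩ : 1 - y ∈ Set.Icc (0:ℝ) 1)
      (by norm_num : (0:ℝ) ≤ 1/2) (by norm_num : (0:ℝ) ≤ 1/2) (by norm_num)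
    simp only [smul_eq_mul] at this
    have e : 1 / 2 * y + 1 / 2 * (1 - y) = (1:ℝ)/2 := by ring
    rw [e] at this
    linarith
  refine Integrable.of_bound (C := (|f 0| + |f 1| + 2 * |f (1/2)|) ^ 2) ?_ ?_
  · exact (hcont.abs.pow 2).aestronglyMeasurable measurableSet_Ioo
  · refine (ae_restrict_iff' measurableSet_Ioo).2 (Filter.Eventually.of_forall fun y hy => ?_)
    have h1 := hub y (Ioo_subset_Icc_self hy)
    have h2 := hlb y (Ioo_subset_Icc_self hy)
    rw [Real.norm_eq_abs, abs_of_nonneg (by positivity)]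
    refine pow_le_pow_left₀ (abs_nonneg _) ?_ 2
    rw [abs_le]
    constructor <;> linarith [neg_abs_le (f (1/2)), abs_nonneg (f (1/2))]

lemma cvx_key {f : ℝ → ℝ} (hf : ConvexOn ℝ (Set.Icc 0 1) f)
    (hint : (∫ x in Set.Icc (0 : ℝ) 1, |f x| ^ 2) ≤ 1) {a b : ℝ} (ha : 0 ≤ a) (hab : a ≤ b)
    (hb : b ≤ 1) {g : ℝ → ℝ} (hg : Continuous g)
    (h : ∀ y ∈ Set.Icc a b, g y ≤ |f y| ^ 2) : ∫ y in a..b, g y ≤ 1 := by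
  have hi := cvx_int hf
  have hs : Set.Icc a b ⊆ Set.Icc 0 1 := Icc_subset_Icc ha hb
  rw [intervalIntegral.integral_of_le hab, ← integral_Icc_eq_integral_Ioc]
  calc ∫ y in Set.Icc a b, g y ≤ ∫ y in Set.Icc a b, |f y| ^ 2 :=
        setIntegral_mono_on (hg.continuousOn.integrableOn_Icc) (hi.mono_set hs) measurableSet_Icc h
    _ ≤ ∫ x in Set.Icc (0 : ℝ) 1, |f x| ^ 2 :=
        setIntegral_mono_set hi (Filter.Eventually.of_forall fun y => by positivity)
          hs.eventuallyLE
    _ ≤ 1 := hint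

lemma sqrt_fin {A L : ℝ} (hL : 0 < L) (h : A ^ 2 * L ≤ 12) :
    A ≤ 2 * Real.sqrt 3 * (Real.sqrt L)⁻¹ := by
  have hs := Real.sqrt_pos.2 hL
  rw [← div_eq_mul_inv, le_div_iff₀ hs]
  refine (le_abs_self _).trans (abs_le_of_sq_le_sq ?_ (by positivity))
  rw [mul_pow, mul_pow, Real.sq_sqrt hL.le, Real.sq_sqrt (by norm_num)]
  linarith

/-- Lemma 4.10 / `lem:convex_1dim_envelope`.
A convex function on `[0,1]` with `∫₀¹ |f|² ≤ 1` satisfies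
`|f(x)| ≤ 2√3 (x^{-1/2} ∨ (1-x)^{-1/2})` on `(0,1)`. -/
theorem statement14 (f : ℝ → ℝ) (hf : ConvexOn ℝ (Set.Icc 0 1) f)
    (hint : (∫ x in Set.Icc (0 : ℝ) 1, |f x| ^ 2) ≤ 1) :
    ∀ x ∈ Set.Ioo (0 : ℝ) 1,
      |f x| ≤ 2 * Real.sqrt 3 * max ((Real.sqrt x)⁻¹) ((Real.sqrt (1 - x))⁻¹) := by
  intro x hx
  obtain ⟨hx0, hx1⟩ := hx
  have hL : 0 < 1 - x := by linarith
  have left : |f x| ^ 2 * x ≤ 12 →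
      |f x| ≤ 2 * Real.sqrt 3 * max ((Real.sqrt x)⁻¹) ((Real.sqrt (1 - x))⁻¹) := fun h =>
    (sqrt_fin hx0 h).trans (mul_le_mul_of_nonneg_left (le_max_left _ _) (by positivity))
  have right : |f x| ^ 2 * (1 - x) ≤ 12 →
      |f x| ≤ 2 * Real.sqrt 3 * max ((Real.sqrt x)⁻¹) ((Real.sqrt (1 - x))⁻¹) := fun h =>
    (sqrt_fin hL h).trans (mul_le_mul_of_nonneg_left (le_max_right _ _) (by positivity))
  rcases le_or_gt 0 (f x) with hpos | hneg
  · by_cases hr : ∀ y ∈ Set.Icc x 1, f x ≤ f y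
    · apply right
      have := cvx_key hf hint hx0.le hx1.le le_rfl (g := fun _ => |f x| ^ 2) continuous_const
        (fun y hy => by
          have := hr y hy
          rw [abs_of_nonneg hpos, abs_of_nonneg (hpos.trans this)]
          exact pow_le_pow_left₀ hpos this 2)
      simp only [intervalIntegral.integral_const, smul_eq_mul] at this
      linarith
    · apply left
      push Not at hr
      obtain ⟨z, hz, hzx⟩ := hr
      have := cvx_key hf hint le_rfl hx0.le hx1.le (g := fun _ => |f x| ^ 2) continuous_const
        (fun y hy => by
          have : f x ≤ f y := by
            by_contra hc
            push Not at hc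
            have h3 := cvx3 hf hy.1 hy.2 hz.1 hz.2
            have hxz : x < z := lt_of_le_of_ne hz.1 (by rintro rfl; exact lt_irrefl _ hzx)
            nlinarith [mul_pos (sub_pos.2 hxz) (sub_pos.2 hc),
              mul_nonneg (sub_nonneg.2 hy.2) (sub_nonneg.2 hzx.le)]
          rw [abs_of_nonneg hpos, abs_of_nonneg (hpos.trans this)]
          exact pow_le_pow_left₀ hpos this 2)
      simp only [intervalIntegral.integral_const, smul_eq_mul] at this
      linarith
  · apply right
    obtain ⟨h, hh⟩ : ∃ h, h = (1 - x) / 2 := ⟨_, rfl⟩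
    have hh0 : 0 < h := by linarith
    have e1 : x = 1 - 2 * h := by linarith
    obtain ⟨M, hM⟩ : ∃ M, M = - f x := ⟨_, rfl⟩
    have hfM : f x = -M := by linarith
    have hM0 : 0 < M := by linarith
    obtain ⟨w, hw⟩ : ∃ w, w = 1 - h := ⟨_, rfl⟩
    have bound : ∀ y, (w - y) * M ≤ h * |f y| → (y - w) * M ≤ h * |f y| →
        M ^ 2 / h ^ 2 * (y - w) ^ 2 ≤ |f y| ^ 2 := by
      intro y h1 h2
      rw [div_mul_eq_mul_div, div_le_iff₀ (by positivity)]
      have : |(y - w) * M| ≤ h * |f y| := abs_le.2 ⟨by linarith, h2⟩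
      have := pow_le_pow_left₀ (abs_nonneg _) this 2
      rw [sq_abs] at this
      nlinarith
    have hg : Continuous (fun y : ℝ => M ^ 2 / h ^ 2 * (y - w) ^ 2) := by fun_prop
    have hI : ∀ a b : ℝ, ∫ y in a..b, M ^ 2 / h ^ 2 * (y - w) ^ 2
        = M ^ 2 / h ^ 2 * (((b - w) ^ 3 - (a - w) ^ 3) / 3) := by
      intro a b
      rw [intervalIntegral.integral_const_mul,
        intervalIntegral.integral_comp_sub_right (fun y => y ^ 2), integral_pow]
      norm_num
    have fin : M ^ 2 / h ^ 2 * (h ^ 3 / 3) ≤ 1 → |f x| ^ 2 * (1 - x) ≤ 12 := by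
      intro h1
      have : M ^ 2 / h ^ 2 * (h ^ 3 / 3) = M ^ 2 * h / 3 := by field_simp
      rw [this] at h1
      rw [sq_abs, hfM, e1]
      nlinarith
    apply fin
    rcases le_or_gt (f w) 0 with hw0 | hw0
    · have := cvx_key hf hint hx0.le (by linarith : x ≤ w) (by linarith) hg (fun y hy => by
        have h3 := cvx3 hf hx0.le hy.1 hy.2 (by linarith)
        have h4 := neg_abs_le (f y)
        have e : w - x = h := by linarith
        rw [e, hfM] at h3
        have h5 := mul_nonneg (sub_nonneg.2 hy.1) (neg_nonneg.2 hw0)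
        have h6 := mul_nonneg hh0.le (abs_nonneg (f y))
        have h7 := mul_nonneg (sub_nonneg.2 hy.2) hM0.le
        apply bound <;> nlinarith)
      rw [hI] at this
      have e : ((w - w) ^ 3 - (x - w) ^ 3) = h ^ 3 := by rw [hw, e1]; ring
      rwa [e] at this
    · have := cvx_key hf hint (by linarith) (by linarith : w ≤ 1) le_rfl hg (fun y hy => by
        have h3 := cvx3 hf hx0.le (by linarith : x ≤ w) hy.1 hy.2
        have h4 := le_abs_self (f y)
        have e : w - x = h := by linarith
        rw [e, hfM] at h3
        have h5 : 0 ≤ (y - x) * f w := mul_nonneg (by linarith [hy.1]) hw0.le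
        have h6 := mul_nonneg hh0.le (abs_nonneg (f y))
        have h7 := mul_nonneg (sub_nonneg.2 hy.1) hM0.le
        apply bound <;> nlinarith)
      rw [hI] at this
      have e : ((1 - w) ^ 3 - (w - w) ^ 3) = h ^ 3 := by rw [hw]; ring
      rwa [e] at this
end
end

section
/- Let $\xi_1,\dots,\xi_n$ be i.i.d. mean-zero real random variables with $\|\xi_1\|_2<\infty$. Then there exists a universal constant $C>0$ such that for all $t\ge 1$ and all $n\ge 1$: $\mathbb{P}\Big(\max_{1\le k\le n}\Big|\frac{1}{k}\sum_{i=1}^k\xi_i\Big|>t\Big)\le C\,\|\xi_1\|_2^2\, t^{-2}$. In particular, $\mathbb{E}\max_{1\le k\le n}\big|k^{-1}\sum_{i=1}^k\xi_i\big|$ is bounded by a constant depending only on $\|\xi_1\|_2$, uniformly in $n$. -/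
open MeasureTheory ProbabilityTheory Set
open scoped ENNReal

noncomputable section

/-- Sequences whose first `n` averages are bounded by `t`. -/
def goodSet (t : ℝ) (n : ℕ) : Set (ℕ → ℝ) :=
  {y | ∀ k : ℕ, 1 ≤ k → k ≤ n → |(k : ℝ)⁻¹ * ∑ i ∈ Finset.range k, y i| ≤ t}

lemma measurableSet_goodSet (t : ℝ) (n : ℕ) : MeasurableSet (goodSet t n) := by
  have : goodSet t n = ⋂ k : ℕ, ⋂ (_ : 1 ≤ k), ⋂ (_ : k ≤ n),
      {y : ℕ → ℝ | |(k : ℝ)⁻¹ * ∑ i ∈ Finset.range k, y i| ≤ t} := by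
    ext y; simp [goodSet]
  rw [this]
  refine MeasurableSet.iInter fun k => MeasurableSet.iInter fun _ => MeasurableSet.iInter fun _ => ?_
  exact measurableSet_le (by fun_prop) (by fun_prop)

lemma goodSet_congr (t : ℝ) (n : ℕ) (y z : ℕ → ℝ) (h : ∀ i < n, y i = z i) :
    y ∈ goodSet t n ↔ z ∈ goodSet t n := by
  have : ∀ k ≤ n, ∑ i ∈ Finset.range k, y i = ∑ i ∈ Finset.range k, z i := fun k hk =>
    Finset.sum_congr rfl fun i hi => h i (by have := Finset.mem_range.1 hi; omega)
  simp only [goodSet, mem_setOf_eq]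
  refine forall_congr' fun k => forall_congr' fun _ => forall_congr' fun hk => ?_
  rw [this k hk]

/-- restricted partial sum -/
def goodSum (t : ℝ) (n : ℕ) : (ℕ → ℝ) → ℝ :=
  (goodSet t n).indicator (fun y => ∑ i ∈ Finset.range n, y i)

lemma measurable_goodSum (t : ℝ) (n : ℕ) : Measurable (goodSum t n) :=
  Measurable.indicator (by fun_prop) (measurableSet_goodSet t n)

lemma goodSum_congr (t : ℝ) (n : ℕ) (y z : ℕ → ℝ) (h : ∀ i < n, y i = z i) :
    goodSum t n y = goodSum t n z := by
  have h1 := goodSet_congr t n y z h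
  have h2 : ∑ i ∈ Finset.range n, y i = ∑ i ∈ Finset.range n, z i :=
    Finset.sum_congr rfl fun i hi => h i (Finset.mem_range.1 hi)
  by_cases hy : y ∈ goodSet t n
  · simp [goodSum, hy, h1.1 hy, h2]
  · have hz : z ∉ goodSet t n := fun hz => hy (h1.2 hz)
    simp [goodSum, hy, hz]

lemma indep_goodSum {Ω : Type*} [MeasurableSpace Ω] {μ : Measure Ω}
    {ξ : ℕ → Ω → ℝ} (hm : ∀ i, Measurable (ξ i)) (hi : iIndepFun ξ μ) (t : ℝ) (n : ℕ) :
    IndepFun (fun ω => goodSum t n (fun i => ξ i ω)) (ξ n) μ := by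
  have h := hi.indepFun_finset (Finset.range n) {n} (by simp) hm
  let e : (Finset.range n → ℝ) → ℕ → ℝ := fun x i =>
    if h : i ∈ Finset.range n then x ⟨i, h⟩ else 0
  have he : Measurable e := by
    refine measurable_pi_lambda _ fun i => ?_
    by_cases h : i ∈ Finset.range n
    · simp only [e, h, dite_true]; fun_prop
    · simp only [e, h, dite_false]; fun_prop
  have hψ : Measurable (fun x : (({n} : Finset ℕ) → ℝ) => x ⟨n, Finset.mem_singleton_self n⟩) :=
    measurable_pi_apply _
  have h' := h.comp (φ := fun x => goodSum t n (e x))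
    (ψ := fun x : (({n} : Finset ℕ) → ℝ) => x ⟨n, Finset.mem_singleton_self n⟩)
    ((measurable_goodSum t n).comp he) hψ
  have e1 : (fun ω => goodSum t n (fun i => ξ i ω)) =
      (fun x => goodSum t n (e x)) ∘ (fun a (i : Finset.range n) ↦ ξ i a) := by
    funext ω
    refine goodSum_congr t n _ _ fun i hi => ?_
    simp [e, hi]
  rw [e1]
  exact h'

lemma maximal_aux {Ω : Type*} [MeasurableSpace Ω] {μ : Measure Ω} [IsProbabilityMeasure μ]
    {ξ : ℕ → Ω → ℝ} (hm : ∀ i, Measurable (ξ i)) (hi : iIndepFun ξ μ)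
    (hL : ∀ i, MemLp (ξ i) 2 μ) (h0 : ∀ i, ∫ ω, ξ i ω ∂μ = 0) {s : ℝ} (hs : 0 ≤ s)
    (hv : ∀ i, ∫ ω, ξ i ω ^ 2 ∂μ = s) {t : ℝ} (ht : 0 ≤ t) (n : ℕ) :
    t ^ 2 * μ.real ((fun ω i => ξ i ω) ⁻¹' goodSet t n)ᶜ +
      ∫ ω in (fun ω i => ξ i ω) ⁻¹' goodSet t n, ((n : ℝ)⁻¹ * ∑ i ∈ Finset.range n, ξ i ω) ^ 2 ∂μ
      ≤ 2 * s * (1 - 1 / ((n : ℝ) + 1)) := by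
  have hmeas : Measurable (fun ω i => ξ i ω) := measurable_pi_lambda _ hm
  set H : ℕ → Set Ω := fun n => (fun ω i => ξ i ω) ⁻¹' goodSet t n with hH
  have hHm : ∀ n, MeasurableSet (H n) := fun n => hmeas (measurableSet_goodSet t n)
  have hSL : ∀ n, MemLp (fun ω => ∑ i ∈ Finset.range n, ξ i ω) 2 μ := fun n =>
    memLp_finsetSum _ fun i _ => hL i
  induction n with
  | zero =>
    have : H 0 = univ := by ext ω; simp [hH, goodSet]; intros; omega
    change t ^ 2 * μ.real (H 0)ᶜ + ∫ ω in H 0, _ ∂μ ≤ _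
    rw [this]
    simp
  | succ n ih =>
    change t ^ 2 * μ.real (H n)ᶜ + ∫ ω in H n, _ ∂μ ≤ _ at ih
    change t ^ 2 * μ.real (H (n+1))ᶜ + ∫ ω in H (n+1), _ ∂μ ≤ _
    have hsub : H (n+1) ⊆ H n := fun ω hω k h1 h2 => hω k h1 (by omega)
    set A : Ω → ℝ := fun ω => (((n+1 : ℕ) : ℝ)⁻¹ * ∑ i ∈ Finset.range (n+1), ξ i ω) ^ 2 with hA
    have hAint : Integrable A μ := ((hSL (n+1)).const_mul _).integrable_sq
    -- splitting
    have hsplit : ∫ ω in H n, A ω ∂μ = ∫ ω in H n \ H (n+1), A ω ∂μ + ∫ ω in H (n+1), A ω ∂μ := by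
      rw [← setIntegral_union disjoint_sdiff_left (hHm _) hAint.integrableOn hAint.integrableOn,
        diff_union_of_subset hsub]
    have hlow : t ^ 2 * μ.real (H n \ H (n+1)) ≤ ∫ ω in H n \ H (n+1), A ω ∂μ := by
      have : ∫ ω in H n \ H (n+1), (t ^ 2 : ℝ) ∂μ ≤ ∫ ω in H n \ H (n+1), A ω ∂μ := by
        refine setIntegral_mono_on (integrable_const _).integrableOn hAint.integrableOn
          ((hHm _).diff (hHm _)) fun ω hω => ?_
        have : t < |((n+1 : ℕ) : ℝ)⁻¹ * ∑ i ∈ Finset.range (n+1), ξ i ω| := by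
          by_contra hc
          push Not at hc
          refine hω.2 fun k h1 h2 => ?_
          rcases Nat.lt_or_ge n k with h | h
          · obtain rfl : k = n + 1 := by omega
            exact hc
          · exact hω.1 k h1 h
        simp only [hA]
        rw [← sq_abs (_ * _)]
        gcongr
      rw [setIntegral_const, smul_eq_mul, mul_comm] at this
      exact this
    have hcompl : μ.real (H (n+1))ᶜ = μ.real (H n)ᶜ + μ.real (H n \ H (n+1)) := by
      rw [← measureReal_union]
      · congr 1
        ext ω
        have := @hsub ω
        simp only [mem_compl_iff, mem_union, mem_diff]
        tauto
      · exact disjoint_compl_left.mono_right diff_subset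
      · exact (hHm _).diff (hHm _)
    -- the second moment recursion
    have hG : ∫ ω, goodSum t n (fun i => ξ i ω) * ξ n ω ∂μ = 0 := by
      rw [(indep_goodSum hm hi t n).integral_fun_mul_eq_mul_integral
        ((measurable_goodSum t n).comp hmeas).aestronglyMeasurable
        (hm n).aestronglyMeasurable, h0, mul_zero]
    have hG' : ∫ ω in H n, (∑ i ∈ Finset.range n, ξ i ω) * ξ n ω ∂μ = 0 := by
      rw [← hG, ← integral_indicator (hHm n)]
      refine integral_congr_ae (Filter.Eventually.of_forall fun ω => ?_)
      by_cases hω : ω ∈ H n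
      · have h2 : (fun i => ξ i ω) ∈ goodSet t n := hω
        simp [hω, goodSum, h2]
      · have h2 : (fun i => ξ i ω) ∉ goodSet t n := hω
        simp [hω, goodSum, h2]
    have i1 : Integrable (fun ω => (∑ i ∈ Finset.range n, ξ i ω) ^ 2) μ := (hSL n).integrable_sq
    have i2 : Integrable (fun ω => ξ n ω ^ 2) μ := (hL n).integrable_sq
    have i12 : Integrable (fun ω => (∑ i ∈ Finset.range n, ξ i ω) ^ 2 + ξ n ω ^ 2) μ := i1.add i2
    have i3 : Integrable (fun ω => (∑ i ∈ Finset.range n, ξ i ω) * ξ n ω) μ :=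
      (hSL n).integrable_mul (hL n)
    have hrec : ∫ ω in H n, A ω ∂μ = (((n:ℝ)+1)⁻¹)^2 *
        (∫ ω in H n, (∑ i ∈ Finset.range n, ξ i ω) ^ 2 ∂μ + ∫ ω in H n, ξ n ω ^ 2 ∂μ) := by
      have : ∀ ω, A ω = (((n:ℝ)+1)⁻¹)^2 * ((∑ i ∈ Finset.range n, ξ i ω) ^ 2 + ξ n ω ^ 2
          + 2 * ((∑ i ∈ Finset.range n, ξ i ω) * ξ n ω)) := by
        intro ω
        simp only [hA, Finset.sum_range_succ]
        push_cast
        ring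
      simp_rw [this]
      rw [integral_const_mul, integral_add i12.integrableOn (i3.const_mul 2).integrableOn,
        integral_add i1.integrableOn i2.integrableOn, integral_const_mul, hG', mul_zero, add_zero]
    have hle : ∫ ω in H n, ξ n ω ^ 2 ∂μ ≤ s := by
      rw [← hv n]
      exact setIntegral_le_integral i2 (Filter.Eventually.of_forall fun ω => sq_nonneg _)
    have hprev : (((n:ℝ)+1)⁻¹)^2 * ∫ ω in H n, (∑ i ∈ Finset.range n, ξ i ω) ^ 2 ∂μ ≤
        ∫ ω in H n, ((n : ℝ)⁻¹ * ∑ i ∈ Finset.range n, ξ i ω) ^ 2 ∂μ := by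
      simp_rw [mul_pow]
      rw [integral_const_mul]
      rcases Nat.eq_zero_or_pos n with rfl | hn
      · simp
      · have : (0:ℝ) < n := by exact_mod_cast hn
        gcongr
        linarith
    have hnum : (((n:ℝ)+1)⁻¹)^2 * s ≤
        2 * s * (1 - 1 / (((n+1:ℕ) : ℝ) + 1)) - 2 * s * (1 - 1 / ((n : ℝ) + 1)) := by
      have hn : (0:ℝ) ≤ n := n.cast_nonneg
      have : 2 * s * (1 - 1 / (((n+1:ℕ) : ℝ) + 1)) - 2 * s * (1 - 1 / ((n : ℝ) + 1))
        - (((n:ℝ)+1)⁻¹)^2 * s = s * n / (((n:ℝ)+1)^2 * (n+2)) := by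
        push_cast
        field_simp
        ring
      have h2 : 0 ≤ s * n / (((n:ℝ)+1)^2 * (n+2)) := by positivity
      linarith
    have hmul : (((n:ℝ)+1)⁻¹)^2 * ∫ ω in H n, ξ n ω ^ 2 ∂μ ≤ (((n:ℝ)+1)⁻¹)^2 * s := by gcongr
    rw [hcompl]
    rw [mul_add] at hrec
    linarith

lemma maximal_prob {Ω : Type*} [MeasurableSpace Ω] {μ : Measure Ω} [IsProbabilityMeasure μ]
    {ξ : ℕ → Ω → ℝ} (hm : ∀ i, Measurable (ξ i)) (hi : iIndepFun ξ μ)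
    (hid : ∀ i, Measure.map (ξ i) μ = Measure.map (ξ 0) μ)
    (hL : MemLp (ξ 0) 2 μ) (h0 : ∫ ω, ξ 0 ω ∂μ = 0) {t : ℝ} (ht : 0 < t) (n : ℕ) :
    μ {ω | ∃ k : ℕ, 1 ≤ k ∧ k ≤ n ∧ t < |(k : ℝ)⁻¹ * ∑ i ∈ Finset.range k, ξ i ω|} ≤
            ENNReal.ofReal (2 * (∫ ω, ξ 0 ω ^ 2 ∂μ) / t ^ 2) := by
  have hD : ∀ i, IdentDistrib (ξ i) (ξ 0) μ μ := fun i =>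
    ⟨(hm i).aemeasurable, (hm 0).aemeasurable, hid i⟩
  have hs : 0 ≤ ∫ ω, ξ 0 ω ^ 2 ∂μ := integral_nonneg fun ω => sq_nonneg _
  have h := maximal_aux hm hi (fun i => (hD i).memLp_iff.2 hL)
    (fun i => by rw [(hD i).integral_eq, h0]) hs (fun i => (hD i).sq.integral_eq) ht.le n
  have hset : {ω | ∃ k : ℕ, 1 ≤ k ∧ k ≤ n ∧ t < |(k : ℝ)⁻¹ * ∑ i ∈ Finset.range k, ξ i ω|} =
      ((fun ω i => ξ i ω) ⁻¹' goodSet t n)ᶜ := by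
    ext ω
    simp only [goodSet, mem_setOf_eq, mem_compl_iff, mem_preimage]
    push Not
    rfl
  rw [hset, ← ofReal_measureReal]
  refine ENNReal.ofReal_le_ofReal ?_
  rw [le_div_iff₀ (by positivity)]
  have h1 : 0 ≤ ∫ ω in (fun ω i => ξ i ω) ⁻¹' goodSet t n,
      ((n : ℝ)⁻¹ * ∑ i ∈ Finset.range n, ξ i ω) ^ 2 ∂μ := integral_nonneg fun ω => sq_nonneg _
  have h2 : 2 * (∫ ω, ξ 0 ω ^ 2 ∂μ) * (1 - 1 / ((n : ℝ) + 1)) ≤ 2 * (∫ ω, ξ 0 ω ^ 2 ∂μ) := by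
    have : (0:ℝ) ≤ 1 / ((n : ℝ) + 1) := by positivity
    exact mul_le_of_le_one_right (by positivity) (by linarith)
  linarith

lemma integral_le_of_tail {Ω : Type*} [MeasurableSpace Ω] {μ : Measure Ω} [IsProbabilityMeasure μ]
    {M : Ω → ℝ} (hM : ∀ ω, 0 ≤ M ω) {a : ℝ} (ha : 0 ≤ a)
    (h : ∀ t : ℝ, 1 ≤ t → μ {ω | t < M ω} ≤ ENNReal.ofReal (a / t ^ 2)) :
    ∫ ω, M ω ∂μ ≤ 1 + a := by
  by_cases hint : Integrable M μ
  swap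
  · rw [integral_undef hint]; linarith
  rw [← ENNReal.ofReal_le_ofReal_iff (by linarith),
    ofReal_integral_eq_lintegral_ofReal hint (Filter.Eventually.of_forall hM),
    lintegral_eq_lintegral_meas_lt μ (Filter.Eventually.of_forall hM) hint.aemeasurable,
    ← Ioc_union_Ioi_eq_Ioi (zero_le_one (α := ℝ)), ENNReal.ofReal_add zero_le_one ha]
  refine (lintegral_union_le _ _ _).trans (add_le_add ?_ ?_)
  · calc _ ≤ ∫⁻ t in Ioc (0:ℝ) 1, 1 := lintegral_mono fun t => prob_le_one
      _ = _ := by simp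
  · have hi := (integrableOn_Ioi_rpow_of_lt (a := -2) (by norm_num) one_pos).const_mul a
    calc _ ≤ ∫⁻ t in Ioi (1:ℝ), ENNReal.ofReal (a * t ^ (-2:ℝ)) := by
          refine setLIntegral_mono' measurableSet_Ioi fun t ht => ?_
          have ht' : (1:ℝ) < t := ht
          refine (h t ht'.le).trans (le_of_eq ?_)
          rw [Real.rpow_neg (by linarith), div_eq_mul_inv]
          norm_cast
      _ = ENNReal.ofReal (∫ t in Ioi (1:ℝ), a * t ^ (-2:ℝ)) := by
          refine (ofReal_integral_eq_lintegral_ofReal hi ?_).symm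
          refine (ae_restrict_iff' measurableSet_Ioi).2 (Filter.Eventually.of_forall fun t ht => ?_)
          have ht' : (1:ℝ) < t := ht
          have : 0 ≤ t ^ (-2:ℝ) := Real.rpow_nonneg (by linarith) _
          exact mul_nonneg ha this
      _ ≤ _ := by
          rw [integral_const_mul, integral_Ioi_rpow_of_lt (by norm_num) one_pos]
          norm_num

/-- maximal inequality for normalized partial sums, from the proof of
Lemma 4.15.
For i.i.d. mean-zero `ξᵢ` with finite second moment,
`P(max_{1 ≤ k ≤ n} |k⁻¹ ∑_{i ≤ k} ξᵢ| > t) ≤ C ‖ξ₁‖₂² t⁻²` for `t ≥ 1`, with a universal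
constant `C`; in particular the expected maximum is bounded uniformly in `n`. -/
theorem statement19 :
    ∃ C : ℝ, 0 < C ∧
      ∀ (Ω : Type) (_ : MeasurableSpace Ω) (μ : Measure Ω), IsProbabilityMeasure μ →
      ∀ ξ : ℕ → Ω → ℝ, (∀ i, Measurable (ξ i)) →
        iIndepFun ξ μ →
        (∀ i, Measure.map (ξ i) μ = Measure.map (ξ 0) μ) →
        MemLp (ξ 0) 2 μ → (∫ ω, ξ 0 ω ∂μ) = 0 →
        (∀ t : ℝ, 1 ≤ t → ∀ n : ℕ, 1 ≤ n →
          μ {ω | ∃ k : ℕ, 1 ≤ k ∧ k ≤ n ∧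
              t < |(k : ℝ)⁻¹ * ∑ i ∈ Finset.range k, ξ i ω|} ≤
            ENNReal.ofReal (C * (∫ ω, ξ 0 ω ^ 2 ∂μ) / t ^ 2)) ∧
        ∀ n : ℕ, 1 ≤ n →
          (∫ ω, sSup {v : ℝ | ∃ k : ℕ, 1 ≤ k ∧ k ≤ n ∧
              v = |(k : ℝ)⁻¹ * ∑ i ∈ Finset.range k, ξ i ω|} ∂μ) ≤
            C * (1 + ∫ ω, ξ 0 ω ^ 2 ∂μ) := by
  refine ⟨2, two_pos, fun Ω _ μ _ ξ hm hi hid hL h0 => ⟨fun t ht n _ =>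
    maximal_prob hm hi hid hL h0 (by linarith) n, fun n hn => ?_⟩⟩
  have hs : 0 ≤ ∫ ω, ξ 0 ω ^ 2 ∂μ := integral_nonneg fun ω => sq_nonneg _
  refine (integral_le_of_tail (a := 2 * ∫ ω, ξ 0 ω ^ 2 ∂μ) (fun ω => ?_) (by positivity)
    fun t ht => ?_).trans (by linarith)
  · refine Real.sSup_nonneg ?_
    rintro v ⟨k, _, _, rfl⟩
    exact abs_nonneg _
  · refine le_trans (measure_mono ?_) (maximal_prob hm hi hid hL h0 (by linarith) n)
    intro ω hω
    have hω' : t < sSup {v : ℝ | ∃ k : ℕ, 1 ≤ k ∧ k ≤ n ∧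
              v = |(k : ℝ)⁻¹ * ∑ i ∈ Finset.range k, ξ i ω|} := hω
    have hne : {v : ℝ | ∃ k : ℕ, 1 ≤ k ∧ k ≤ n ∧
              v = |(k : ℝ)⁻¹ * ∑ i ∈ Finset.range k, ξ i ω|}.Nonempty := ⟨_, 1, le_rfl, hn, rfl⟩
    obtain ⟨v, ⟨k, h1, h2, rfl⟩, hv⟩ := exists_lt_of_lt_csSup hne hω'
    exact ⟨k, h1, h2, hv⟩
end
end
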